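/- arXiv:1908.03294 — 8 statements merged into one kernel-verified Lean document; each statement's English description precedes it below -/
import Mathlib

section
/- Let q be a prime power and let C be an [n,k] code over 𝔽_q with generator matrix G (a k×n matrix over 𝔽_q whose rows form a basis of C). Then C is an LCD code if and only if the k×k matrix G·Gᵀ is nonsingular. -/
open Matrix Finset

/-- The (Hamming) weight of a vector. -/
def wt {R : Type*} [Zero R] [DecidableEq R] {n : ℕ} (x : Fin n → R) : ℕ :=
  (Finset.univ.filter fun i => x i ≠ 0).card

/-- The dual code of a linear code, w.r.t. the standard inner product. -/
def dualCode {R : Type*} [CommRing R] {n : ℕ} (C : Submodule R (Fin n → R)) :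
    Submodule R (Fin n → R) where
  carrier := {x | ∀ y ∈ C, ∑ i, x i * y i = 0}
  add_mem' := by
    intro a b ha hb y hy
    have ha' := ha y hy
    have hb' := hb y hy
    simp only [Set.mem_setOf_eq, Pi.add_apply, add_mul, Finset.sum_add_distrib, ha', hb',
      add_zero]
  zero_mem' := by intro y hy; simp
  smul_mem' := by
    intro c x hx y hy
    have h := hx y hy
    simp only [Set.mem_setOf_eq, Pi.smul_apply, smul_eq_mul, mul_assoc, ← Finset.mul_sum, h,
      mul_zero]

/-- A linear code is LCD if it intersects its dual trivially. -/
def IsLCD {R : Type*} [CommRing R] {n : ℕ} (C : Submodule R (Fin n → R)) : Prop :=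
  C ⊓ dualCode C = ⊥

/-- `C` has minimum weight `d`. -/
def HasMinWeight {R : Type*} [CommRing R] [DecidableEq R] {n : ℕ}
    (C : Submodule R (Fin n → R)) (d : ℕ) : Prop :=
  (∃ x ∈ C, x ≠ 0 ∧ wt x = d) ∧ ∀ x ∈ C, x ≠ 0 → d ≤ wt x

/-- The dual distance of `C` is at least `d`. -/
def DualDistGe {R : Type*} [CommRing R] [DecidableEq R] {n : ℕ}
    (C : Submodule R (Fin n → R)) (d : ℕ) : Prop :=
  ∀ x ∈ dualCode C, x ≠ 0 → d ≤ wt x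

/-- A monomial matrix: exactly one nonzero entry in each row and column. -/
def IsMonomial {R : Type*} [CommRing R] {n : ℕ} (P : Matrix (Fin n) (Fin n) R) : Prop :=
  ∃ (σ : Equiv.Perm (Fin n)) (c : Fin n → R), (∀ i, c i ≠ 0) ∧
    ∀ i j, P i j = if σ i = j then c i else 0

/-- Two codes of the same length are equivalent if one is the image of the other
under (right) multiplication by a monomial matrix. -/
def codeEquiv {R : Type*} [CommRing R] {n : ℕ} (C₁ C₂ : Submodule R (Fin n → R)) : Prop :=
  ∃ P : Matrix (Fin n) (Fin n) R, IsMonomial P ∧ C₂ = C₁.map (Matrix.vecMulLinear P)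

/-- `G` is a generator matrix of `C`: the rows of `G` form a basis of `C`. -/
def IsGenMatrix {R : Type*} [CommRing R] {k n : ℕ} (C : Submodule R (Fin n → R))
    (G : Matrix (Fin k) (Fin n) R) : Prop :=
  LinearIndependent R (fun i : Fin k => G i) ∧
    Submodule.span R (Set.range fun i : Fin k => G i) = C

/-- The code generated by the rows of a matrix. -/
def rowSpace {R : Type*} [CommRing R] {k n : ℕ} (G : Matrix (Fin k) (Fin n) R) :
    Submodule R (Fin n → R) :=
  Submodule.span R (Set.range fun i : Fin k => G i)

/-- `[k]_q = (q^k - 1)/(q - 1) = 1 + q + ⋯ + q^(k-1)`. -/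
def qrep (q k : ℕ) : ℕ := ∑ i ∈ Finset.range k, q ^ i

/-- The columns of the simplex-code generator matrix `S_{q,k}`, defined inductively. -/
def simplexCol (q : ℕ) : (k : ℕ) → ℕ → (Fin k → ZMod q)
  | 0, _ => fun i => i.elim0
  | (k+1), j =>
    if j < qrep q k then Fin.snoc (simplexCol q k j) 0
    else if j = qrep q k then Fin.snoc (fun _ => 0) 1
    else Fin.snoc (simplexCol q k ((j - qrep q k - 1) % qrep q k))
      (((j - qrep q k - 1) / qrep q k + 1 : ℕ) : ZMod q)

/-- The generator matrix `S_{q,k}` of the simplex code. -/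
def simplexMatrix (q k : ℕ) : Matrix (Fin k) (Fin (qrep q k)) (ZMod q) :=
  Matrix.of fun i j => simplexCol q k (j : ℕ) i

/-- Juxtaposition `(A | B)` of two matrices. -/
def hcat {R : Type*} {k a b : ℕ} (A : Matrix (Fin k) (Fin a) R) (B : Matrix (Fin k) (Fin b) R) :
    Matrix (Fin k) (Fin (a + b)) R :=
  Matrix.of fun i j =>
    if h : (j : ℕ) < a then A i ⟨j, h⟩ else B i ⟨(j : ℕ) - a, by have := j.isLt; omega⟩

/-- `A^{(s)}`: juxtaposition of `s` copies of `A`. -/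
def reps {R : Type*} {k r : ℕ} (A : Matrix (Fin k) (Fin r) R) (s : ℕ) :
    Matrix (Fin k) (Fin (r * s)) R :=
  Matrix.of fun i j => A i ⟨(j : ℕ) % r,
    Nat.mod_lt _ (Nat.pos_of_ne_zero fun hr => by subst hr; simpa using j.isLt)⟩

/-- The list of columns of `G_{q,k}(m)`: `m i` copies of the `i`-th column of `S_{q,k}`. -/
def colList (q k : ℕ) (m : Fin (qrep q k) → ℕ) : List (Fin k → ZMod q) :=
  (List.finRange (qrep q k)).flatMap fun i => List.replicate (m i) (simplexCol q k (i : ℕ))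

lemma colList_length (q k : ℕ) (m : Fin (qrep q k) → ℕ) :
    (colList q k m).length = ∑ i, m i := by
  simp [colList, List.length_flatMap, Function.comp_def]
  rw [← List.ofFn_eq_map, List.sum_ofFn]

/-- The matrix `G_{q,k}(m)`, consisting of `m i` copies of the `i`-th column of `S_{q,k}`. -/
def Gqk (q k : ℕ) (m : Fin (qrep q k) → ℕ) : Matrix (Fin k) (Fin (∑ i, m i)) (ZMod q) :=
  Matrix.of fun i j => (colList q k m).get (Fin.cast (colList_length q k m).symm j) i

/-- A vector lies in the dual of the row space of `G` iff it is orthogonal to all rows of `G`. -/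
lemma mem_dualCode_rowSpace_iff {R : Type*} [CommRing R] {k n : ℕ}
    (G : Matrix (Fin k) (Fin n) R) (x : Fin n → R) :
    x ∈ dualCode (rowSpace G) ↔ x ᵥ* Gᵀ = 0 := by
  constructor
  · intro hx
    funext i
    exact hx (G i) (Submodule.subset_span ⟨i, rfl⟩)
  · intro hx y hy
    change x ⬝ᵥ y = 0
    induction hy using Submodule.span_induction with
    | mem y hy =>
      obtain ⟨i, rfl⟩ := hy
      exact congrFun hx i
    | zero => exact dotProduct_zero x
    | add y z _ _ hy hz => rw [dotProduct_add, hy, hz, add_zero]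
    | smul c y _ hy => rw [dotProduct_smul, hy, smul_zero]

/-- The row space of `G` consists of the vectors `v ᵥ* G`. -/
lemma mem_rowSpace_iff {R : Type*} [CommRing R] {k n : ℕ}
    (G : Matrix (Fin k) (Fin n) R) (x : Fin n → R) :
    x ∈ rowSpace G ↔ ∃ v, v ᵥ* G = x := by
  have h : rowSpace G = LinearMap.range G.vecMulLinear := (range_vecMulLinear G).symm
  rw [h, LinearMap.mem_range]
  rfl

/-- Massey's characterization: a code is LCD iff `G * Gᵀ` is nonsingular for a
generator matrix `G`. -/
theorem lcd_iff_det_isUnit {q n k : ℕ} (hq : IsPrimePow q)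
    {F : Type} [Field F] [Fintype F] (hF : Fintype.card F = q)
    (C : Submodule F (Fin n → F)) (hC : Module.finrank F C = k)
    (G : Matrix (Fin k) (Fin n) F) (hG : IsGenMatrix C G) :
    IsLCD C ↔ IsUnit (G * Gᵀ).det := by
  obtain ⟨hli, rfl⟩ := hG
  change IsLCD (rowSpace G) ↔ _
  have hinj : Function.Injective G.vecMul := vecMul_injective_iff.mpr hli
  rw [← isUnit_iff_isUnit_det, ← vecMul_injective_iff_isUnit]
  constructor
  · intro h
    refine (injective_iff_map_eq_zero (G * Gᵀ).vecMulLinear).mpr fun v hv => ?_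
    have hmem : v ᵥ* G ∈ rowSpace G ⊓ dualCode (rowSpace G) :=
      ⟨(mem_rowSpace_iff G _).mpr ⟨v, rfl⟩,
        (mem_dualCode_rowSpace_iff G _).mpr ((vecMul_vecMul v G Gᵀ).trans hv)⟩
    rw [h, Submodule.mem_bot] at hmem
    exact hinj (hmem.trans (zero_vecMul G).symm)
  · intro h
    refine (Submodule.eq_bot_iff _).mpr ?_
    rintro x ⟨hx, hx'⟩
    obtain ⟨v, rfl⟩ := (mem_rowSpace_iff G x).mp hx
    have hv := (mem_dualCode_rowSpace_iff G _).mp hx'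
    rw [vecMul_vecMul] at hv
    rw [h (hv.trans (zero_vecMul _).symm), zero_vecMul]
end

section
/- Let q be a prime power, let A be a k×ℓ matrix over 𝔽_q, and let B and B′ be k×m matrices over 𝔽_q. If there is an (ℓ+m)×(ℓ+m) monomial matrix P over 𝔽_q such that the juxtaposed matrix (A | B′) equals (A | B)·P, then there is an m×m monomial matrix P* over 𝔽_q such that B′ = B·P*. -/
open Matrix Finset

/-- If two families indexed by a disjoint union agree on the left summand and up to a permutation
of the whole index type, then their restrictions to the right summand agree up to a permutation. -/
lemma exists_perm_of_sumElim_comp {α β γ : Type*} [Finite α] [Finite β]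
    (f : α → γ) (g g' : β → γ) (e : Equiv.Perm (α ⊕ β))
    (h : Sum.elim f g = Sum.elim f g' ∘ e) : ∃ τ : Equiv.Perm β, g = g' ∘ τ := by
  have fiber_equiv (c : γ) : Nonempty ({b // g b = c} ≃ {b // g' b = c}) := by
    have hcard : Nat.card {x // Sum.elim f g x = c} = Nat.card {x // Sum.elim f g' x = c} :=
      Nat.card_congr (e.subtypeEquiv fun x => by rw [h, Function.comp_apply])
    simp only [Nat.card_congr Equiv.subtypeSum, Nat.card_sum, Sum.elim_inl, Sum.elim_inr,
      Nat.add_left_cancel_iff] at hcard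
    exact ⟨(Finite.equivFin _).trans ((finCongr hcard).trans (Finite.equivFin _).symm)⟩
  let τ (c : γ) := (fiber_equiv c).some
  exact ⟨Equiv.ofFiberEquiv τ, funext fun b => (Equiv.ofFiberEquiv_map τ b).symm⟩

lemma hcat_col_finSumFinEquiv {R : Type*} {k a b : ℕ} (A : Matrix (Fin k) (Fin a) R)
    (B : Matrix (Fin k) (Fin b) R) (j : Fin a ⊕ Fin b) :
    (hcat A B).col (finSumFinEquiv j) = Sum.elim A.col B.col j := by
  ext i
  cases j <;> simp [hcat]

lemma mul_monomial_apply {R : Type*} [CommRing R] {k n : ℕ} (B : Matrix (Fin k) (Fin n) R)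
    {P : Matrix (Fin n) (Fin n) R} {σ : Equiv.Perm (Fin n)} {c : Fin n → R}
    (hP : ∀ i j, P i j = if σ i = j then c i else 0) (i : Fin k) (j : Fin n) :
    (B * P) i (σ j) = B i j * c j := by
  simp [Matrix.mul_apply, hP]

/-- If `(A | B') = (A | B) · P` for a monomial matrix `P`, then `B' = B · P*` for some
monomial matrix `P*`. -/
theorem monomial_of_juxtaposition {q k ℓ m : ℕ} (hq : IsPrimePow q)
    {F : Type} [Field F] [Fintype F] (hF : Fintype.card F = q)
    (A : Matrix (Fin k) (Fin ℓ) F) (B B' : Matrix (Fin k) (Fin m) F)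
    (P : Matrix (Fin (ℓ + m)) (Fin (ℓ + m)) F) (hP : IsMonomial P)
    (h : hcat A B' = hcat A B * P) :
    ∃ Pstar : Matrix (Fin m) (Fin m) F, IsMonomial Pstar ∧ B' = B * Pstar := by
  obtain ⟨σ, c, hc, hPc⟩ := hP
  let cls : (Fin k → F) → MulAction.orbitRel.Quotient Fˣ (Fin k → F) := Quotient.mk _
  have cls_eq (v w : Fin k → F) : cls v = cls w ↔ ∃ u : Fˣ, u • w = v := by
    rw [Quotient.eq, MulAction.orbitRel_apply]
    rfl
  let e : Equiv.Perm (Fin ℓ ⊕ Fin m) := (finSumFinEquiv.trans σ).trans finSumFinEquiv.symm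
  have hcols : Sum.elim (cls ∘ A.col) (cls ∘ B.col) =
      Sum.elim (cls ∘ A.col) (cls ∘ B'.col) ∘ e := by
    funext j
    simp only [← Sum.comp_elim, Function.comp_apply, ← hcat_col_finSumFinEquiv]
    refine ((cls_eq _ _).2 ⟨Units.mk0 _ (hc (finSumFinEquiv j)), ?_⟩).symm
    ext i
    simp [e, h, mul_monomial_apply _ hPc, Units.smul_def, mul_comm]
  obtain ⟨τ, hτ⟩ := exists_perm_of_sumElim_comp _ _ _ e hcols
  have hscale (j : Fin m) : ∃ u : Fˣ, u • B.col j = B'.col (τ j) :=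
    (cls_eq _ _).1 (congrFun hτ j).symm
  choose u hu using hscale
  refine ⟨Matrix.of fun i j => if τ i = j then (u i : F) else 0,
    ⟨τ, fun i => u i, fun i => (u i).ne_zero, fun _ _ => rfl⟩, ?_⟩
  ext i j
  obtain ⟨j, rfl⟩ := τ.surjective j
  refine (congrFun (hu j) i).symm.trans ((mul_comm _ _).trans ?_)
  exact (mul_monomial_apply (c := fun i => (u i : F)) B (fun _ _ => rfl) i j).symm
end

section
/- Suppose q ∈ {2,3} and k ≥ 2. If there exists an LCD [n,k,d₀] code over 𝔽_q with dual distance d⊥ ≥ 2, then there exists an LCD [n+1,k,d] code over 𝔽_q with d ∈ {d₀, d₀+1} and dual distance d⊥ ≥ 2. -/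
open Matrix Finset

theorem mem_dualCode {R : Type*} [CommRing R] {n : ℕ} {C : Submodule R (Fin n → R)}
    {x : Fin n → R} : x ∈ dualCode C ↔ ∀ y ∈ C, x ⬝ᵥ y = 0 :=
  Iff.rfl

/-- Over a field, the dual distance is at least two iff no coordinate vanishes on the code. -/
theorem dualDistGe_two_iff {F : Type*} [Field F] [DecidableEq F] {n : ℕ}
    {C : Submodule F (Fin n → F)} : DualDistGe C 2 ↔ ∀ i, ∃ y ∈ C, y i ≠ 0 := by
  constructor
  · intro h i
    by_contra! hi
    have hdual : Pi.single i (1 : F) ∈ dualCode C := by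
      rw [mem_dualCode]
      intro y hy
      simp [hi y hy]
    have h2 := h _ hdual (by simp)
    have h1 : wt (Pi.single i (1 : F) : Fin n → F) ≤ 1 := by
      refine Finset.card_le_one.2 fun a ha b hb => ?_
      simp only [Finset.mem_filter, Finset.mem_univ, true_and, ne_eq, Pi.single_apply,
        ite_eq_right_iff, one_ne_zero, imp_false, not_not] at ha hb
      rw [ha, hb]
    omega
  · intro h x hx hx0
    by_contra! hlt
    obtain ⟨i, hi⟩ := Function.ne_iff.1 hx0
    obtain ⟨y, hy, hyi⟩ := h i
    have hsum := mem_dualCode.1 hx y hy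
    have hsupp : ∀ j, j ≠ i → x j = 0 := by
      intro j hj
      by_contra hxj
      exact hj (Finset.card_le_one.1 (Nat.le_of_lt_succ hlt) j (by simpa using hxj) i
        (by simpa using hi))
    rw [dotProduct, Finset.sum_eq_single i (fun j _ hj => by rw [hsupp j hj, zero_mul])
      (by simp)] at hsum
    exact mul_ne_zero hi hyi hsum

/-- Append to a vector its inner product with `u`. -/
def snocDot {R : Type*} [CommRing R] {n : ℕ} (u : Fin n → R) :
    (Fin n → R) →ₗ[R] (Fin (n + 1) → R) where
  toFun x := Fin.snoc x (u ⬝ᵥ x)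
  map_add' x y := by
    ext i
    refine Fin.lastCases ?_ (fun j => ?_) i <;> simp [dotProduct_add]
  map_smul' c x := by
    ext i
    refine Fin.lastCases ?_ (fun j => ?_) i <;> simp [dotProduct_smul]

section

variable {R : Type*} [CommRing R] {n : ℕ} (u x : Fin n → R)

@[simp] theorem snocDot_castSucc (i : Fin n) : snocDot u x i.castSucc = x i := by
  simp [snocDot]

@[simp] theorem snocDot_last : snocDot u x (Fin.last n) = u ⬝ᵥ x := by
  simp [snocDot]

theorem snocDot_injective : Function.Injective (snocDot u) := by
  intro a b hab
  ext i
  simpa using congrFun hab i.castSucc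

theorem snocDot_dotProduct_snocDot (y : Fin n → R) :
    snocDot u x ⬝ᵥ snocDot u y = x ⬝ᵥ y + (u ⬝ᵥ x) * (u ⬝ᵥ y) := by
  simp [dotProduct, Fin.sum_univ_castSucc]

theorem wt_snocDot [DecidableEq R] :
    wt (snocDot u x) = wt x + if u ⬝ᵥ x ≠ 0 then 1 else 0 := by
  simp only [wt, Finset.card_filter, Fin.sum_univ_castSucc, snocDot_castSucc, snocDot_last]

end

/-- Appending the inner product with `u ∈ C` preserves being LCD when `1 + u ⬝ u ≠ 0`. -/
theorem IsLCD.map_snocDot {F : Type*} [Field F] {n : ℕ} {C : Submodule F (Fin n → F)}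
    (hC : IsLCD C) {u : Fin n → F} (hu : u ∈ C) (huu : 1 + u ⬝ᵥ u ≠ 0) :
    IsLCD (C.map (snocDot u)) := by
  refine (Submodule.eq_bot_iff _).2 ?_
  rintro _ ⟨⟨x, hx, rfl⟩, hdual⟩
  have hmem : x + (u ⬝ᵥ x) • u ∈ C ⊓ dualCode C := by
    refine ⟨C.add_mem hx (C.smul_mem _ hu), mem_dualCode.2 fun y hy => ?_⟩
    have := mem_dualCode.1 hdual _ (Submodule.mem_map_of_mem hy)
    rw [snocDot_dotProduct_snocDot] at this
    rw [add_dotProduct, smul_dotProduct, smul_eq_mul]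
    exact this
  rw [hC, Submodule.mem_bot] at hmem
  have hdot : (u ⬝ᵥ x) * (1 + u ⬝ᵥ u) = 0 := by
    have := congrArg (u ⬝ᵥ ·) hmem
    simp only [dotProduct_add, dotProduct_smul, smul_eq_mul, dotProduct_zero] at this
    linear_combination this
  rw [(mul_eq_zero.1 hdot).resolve_right huu, zero_smul, add_zero] at hmem
  rw [hmem, map_zero]

theorem HasMinWeight.map_snocDot {R : Type*} [CommRing R] [DecidableEq R] {n d : ℕ}
    {C : Submodule R (Fin n → R)} (hC : HasMinWeight C d) (u : Fin n → R) :
    ∃ d', (d' = d ∨ d' = d + 1) ∧ HasMinWeight (C.map (snocDot u)) d' := by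
  obtain ⟨⟨x, hx, hx0, hxd⟩, hmin⟩ := hC
  have hne : ∀ y, y ≠ 0 → snocDot u y ≠ 0 := fun y hy =>
    (map_ne_zero_iff _ (snocDot_injective u)).2 hy
  by_cases h : ∃ y ∈ C, y ≠ 0 ∧ wt (snocDot u y) = d
  · obtain ⟨y, hy, hy0, hyd⟩ := h
    refine ⟨d, .inl rfl, ⟨_, Submodule.mem_map_of_mem hy, hne y hy0, hyd⟩, ?_⟩
    rintro _ ⟨z, hz, rfl⟩ hz0
    have := hmin z hz (by rintro rfl; simp at hz0)
    rw [wt_snocDot]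
    omega
  · push Not at h
    have hlow : ∀ z ∈ C, z ≠ 0 → d + 1 ≤ wt (snocDot u z) := by
      intro z hz hz0
      have h₁ := hmin z hz hz0
      have h₂ := h z hz hz0
      rw [wt_snocDot] at h₂ ⊢
      omega
    refine ⟨d + 1, .inr rfl, ⟨_, Submodule.mem_map_of_mem hx, hne x hx0, ?_⟩, ?_⟩
    · have h₁ := hlow x hx hx0
      rw [wt_snocDot, hxd] at h₁ ⊢
      split_ifs at h₁ ⊢ <;> omega
    · rintro _ ⟨z, hz, rfl⟩ hz0
      exact hlow z hz (by rintro rfl; simp at hz0)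

theorem DualDistGe.map_snocDot {F : Type*} [Field F] [DecidableEq F] {n : ℕ}
    {C : Submodule F (Fin n → F)} (hC : DualDistGe C 2) {u : Fin n → F}
    (hu : u ∉ dualCode C) : DualDistGe (C.map (snocDot u)) 2 := by
  rw [dualDistGe_two_iff] at hC ⊢
  intro i
  refine Fin.lastCases ?_ (fun j => ?_) i
  · rw [mem_dualCode] at hu
    push Not at hu
    obtain ⟨y, hy, hyu⟩ := hu
    exact ⟨_, Submodule.mem_map_of_mem hy, by simpa using hyu⟩
  · obtain ⟨y, hy, hyj⟩ := hC j
    exact ⟨_, Submodule.mem_map_of_mem hy, by simpa using hyj⟩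

/-- Over a field with at most three elements, the form `x ⬝ x` is not identically `-1` on the
nonzero vectors of a code of dimension at least two. -/
theorem exists_ne_zero_one_add_dotProduct_self_ne_zero {q n : ℕ} [Fact q.Prime]
    (hq : q = 2 ∨ q = 3) {C : Submodule (ZMod q) (Fin n → ZMod q)}
    (hk : 2 ≤ Module.finrank (ZMod q) C) : ∃ u ∈ C, u ≠ 0 ∧ 1 + u ⬝ᵥ u ≠ 0 := by
  by_contra! h
  have hC : C ≠ ⊥ := by
    rintro rfl
    simp at hk
  obtain ⟨u, hu, hu0⟩ := C.exists_mem_ne_zero_of_ne_bot hC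
  obtain ⟨v, hv, hvu⟩ : ∃ v ∈ C, v ∉ Submodule.span (ZMod q) {u} := by
    by_contra! hle
    have := Submodule.finrank_mono (show C ≤ Submodule.span (ZMod q) {u} from hle)
    rw [finrank_span_singleton hu0] at this
    omega
  have hv0 : v ≠ 0 := by
    rintro rfl
    exact hvu (zero_mem _)
  have hadd : u + v ≠ 0 := fun h0 => hvu <| by
    rw [← neg_eq_of_add_eq_zero_right h0]
    exact neg_mem (Submodule.mem_span_singleton_self u)
  have hsub : u - v ≠ 0 := fun h0 => hvu <| by
    rw [← sub_eq_zero.1 h0]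
    exact Submodule.mem_span_singleton_self u
  have h₁ := h u hu hu0
  have h₂ := h v hv hv0
  have h₃ := h _ (C.add_mem hu hv) hadd
  have h₄ := h _ (C.sub_mem hu hv) hsub
  simp only [add_dotProduct, dotProduct_add, sub_dotProduct, dotProduct_sub,
    dotProduct_comm v u] at h₃ h₄
  refine one_ne_zero (α := ZMod q) ?_
  have hchar : (q : ZMod q) = 0 := ZMod.natCast_self q
  rcases hq with rfl | rfl <;> push_cast at hchar
  · linear_combination h₁ + h₂ - h₃ + (u ⬝ᵥ v) * hchar
  · linear_combination h₃ + h₄ - 2 * h₁ - 2 * h₂ + hchar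

/-- From an LCD `[n,k,d₀]` code over `𝔽_q` (`q ∈ {2,3}`, `k ≥ 2`) with dual distance `≥ 2`,
one obtains an LCD `[n+1,k,d]` code with `d ∈ {d₀, d₀+1}` and dual distance `≥ 2`. -/
theorem lcd_extend {q k n d₀ : ℕ} (hq : q = 2 ∨ q = 3) (hk : 2 ≤ k)
    (h : ∃ C : Submodule (ZMod q) (Fin n → ZMod q),
      Module.finrank (ZMod q) C = k ∧ IsLCD C ∧ HasMinWeight C d₀ ∧ DualDistGe C 2) :
    ∃ d : ℕ, (d = d₀ ∨ d = d₀ + 1) ∧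
      ∃ C' : Submodule (ZMod q) (Fin (n + 1) → ZMod q),
        Module.finrank (ZMod q) C' = k ∧ IsLCD C' ∧ HasMinWeight C' d ∧ DualDistGe C' 2 := by
  have : Fact q.Prime := ⟨by rcases hq with rfl | rfl <;> norm_num⟩
  obtain ⟨C, hdim, hlcd, hmin, hdual⟩ := h
  obtain ⟨u, hu, hu0, huu⟩ :=
    exists_ne_zero_one_add_dotProduct_self_ne_zero hq (hdim.symm ▸ hk)
  have hud : u ∉ dualCode C := fun hu' => hu0 <| by
    have hmem : u ∈ C ⊓ dualCode C := ⟨hu, hu'⟩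
    rwa [hlcd] at hmem
  obtain ⟨d, hd, hmin'⟩ := hmin.map_snocDot u
  refine ⟨d, hd, C.map (snocDot u), ?_, hlcd.map_snocDot hu huu, ?_, ?_⟩
  · rw [← hdim, (Submodule.equivMapOfInjective _ (snocDot_injective u) C).finrank_eq]
  · exact hmin'
  · exact hdual.map_snocDot hud
end

section
/- Suppose (q,k₀) ∈ {(2,3),(3,2)}, k ≥ k₀, and n is a positive integer with n ≡ 0 (mod [k]_q). Then there is no LCD [n,k,g_q(n,k)] code over 𝔽_q. -/
open Matrix Finset

/-- The Griesmer bound value `g_q(n,k)`. -/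
noncomputable def griesmer (q n k : ℕ) : ℕ :=
  sSup {d : ℕ | ∑ i ∈ Finset.range k, (d + q ^ i - 1) / q ^ i ≤ n}

lemma griesmer_set_bddAbove (q n : ℕ) {k : ℕ} (hk : 0 < k) :
    BddAbove {d : ℕ | ∑ i ∈ Finset.range k, (d + q ^ i - 1) / q ^ i ≤ n} := by
  refine ⟨n, fun d hd => ?_⟩
  have h := Finset.single_le_sum (f := fun i => (d + q ^ i - 1) / q ^ i)
    (fun _ _ => Nat.zero_le _) (Finset.mem_range.2 hk)
  simp only [Set.mem_ofPred_eq] at hd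
  simp only [pow_zero, Nat.add_sub_cancel, Nat.div_one] at h
  exact h.trans hd

lemma mul_pow_le_griesmer {q k : ℕ} (hq : 0 < q) (hk : 0 < k) (s : ℕ) :
    s * q ^ (k - 1) ≤ griesmer q (qrep q k * s) k := by
  refine le_csSup (griesmer_set_bddAbove q _ hk) ?_
  have hterm : ∀ i ∈ Finset.range k,
      (s * q ^ (k - 1) + q ^ i - 1) / q ^ i = q ^ (k - 1 - i) * s := by
    intro i hi
    have hi' : i < k := Finset.mem_range.1 hi
    have hpos : 0 < q ^ i := pow_pos hq i
    have hsplit : q ^ (k - 1) = q ^ i * q ^ (k - 1 - i) := by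
      rw [← pow_add]; congr 1; omega
    have hnum : s * q ^ (k - 1) + q ^ i - 1 = (q ^ i - 1) + q ^ i * (q ^ (k - 1 - i) * s) := by
      have : s * q ^ (k - 1) = q ^ i * (q ^ (k - 1 - i) * s) := by rw [hsplit]; ring
      omega
    rw [hnum, Nat.add_mul_div_left _ _ hpos, Nat.div_eq_of_lt (by omega), zero_add]
  rw [Set.mem_ofPred_eq, Finset.sum_congr rfl hterm, ← Finset.sum_mul,
    Finset.sum_range_reflect (fun j => q ^ j) k, qrep]

section Averaging

variable {q n : ℕ} [Fact q.Prime] (C : Submodule (ZMod q) (Fin n → ZMod q))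

lemma card_coord_ne_zero_le [Fintype C] (i : Fin n) :
    (Finset.univ.filter fun x : C => (x : Fin n → ZMod q) i ≠ 0).card ≤
      q ^ Module.finrank (ZMod q) C - q ^ (Module.finrank (ZMod q) C - 1) := by
  let f : C →ₗ[ZMod q] ZMod q := (LinearMap.proj i).comp C.subtype
  have hker : q ^ (Module.finrank (ZMod q) C - 1) ≤ Nat.card (LinearMap.ker f) := by
    rw [Module.natCard_eq_pow_finrank (K := ZMod q), Nat.card_zmod]
    refine Nat.pow_le_pow_right (Fact.out : q.Prime).pos ?_
    have h₁ := f.finrank_range_add_finrank_ker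
    have h₂ := (LinearMap.range f).finrank_le
    rw [Module.finrank_self] at h₂
    omega
  have hzero : Nat.card (LinearMap.ker f) =
      (Finset.univ.filter fun x : C => (x : Fin n → ZMod q) i = 0).card := by
    exact Nat.subtype_card _ fun x => by simp [f]
  have hcard : Fintype.card C = q ^ Module.finrank (ZMod q) C := by
    rw [← Nat.card_eq_fintype_card, Module.natCard_eq_pow_finrank (K := ZMod q), Nat.card_zmod]
  have hsplit := Finset.card_filter_add_card_filter_not (s := (Finset.univ : Finset C))
    (fun x : C => (x : Fin n → ZMod q) i = 0)
  rw [Finset.card_univ, hcard] at hsplit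
  simp only [ne_eq]
  omega

lemma sum_wt_le [Fintype C] :
    ∑ x : C, wt (x : Fin n → ZMod q) ≤
      n * (q ^ Module.finrank (ZMod q) C - q ^ (Module.finrank (ZMod q) C - 1)) := by
  have hswap : ∑ x : C, wt (x : Fin n → ZMod q) =
      ∑ i, (Finset.univ.filter fun x : C => (x : Fin n → ZMod q) i ≠ 0).card := by
    simp only [wt, Finset.card_filter]
    exact Finset.sum_comm
  rw [hswap]
  refine (Finset.sum_le_card_nsmul _ _ _ fun i _ => card_coord_ne_zero_le C i).trans ?_
  simp

/-- A code of length `s [k]_q` whose nonzero weights are all at least `s q^(k-1)` is a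
constant weight code. -/
lemma wt_eq_of_le_wt {k s : ℕ} (hk : 0 < k) (hdim : Module.finrank (ZMod q) C = k)
    (hn : n = qrep q k * s) (hwt : ∀ x ∈ C, x ≠ 0 → s * q ^ (k - 1) ≤ wt x)
    {x : Fin n → ZMod q} (hx : x ∈ C) (hx0 : x ≠ 0) : wt x = s * q ^ (k - 1) := by
  classical
  have : Fintype C := Fintype.ofFinite C
  have hq : 0 < q := (Fact.out : q.Prime).pos
  have hcard : Fintype.card C = q ^ k := by
    rw [← Nat.card_eq_fintype_card, Module.natCard_eq_pow_finrank (K := ZMod q), Nat.card_zmod,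
      hdim]
  have hsum := sum_wt_le C
  have hgeom : (q - 1) * qrep q k = q ^ k - 1 := by
    have hmul := geom_sum_mul_add (q - 1) k
    rw [Nat.sub_add_cancel (Nat.one_le_of_lt hq)] at hmul
    rw [qrep, mul_comm]
    omega
  have hupper : n * (q ^ k - q ^ (k - 1)) = (q ^ k - 1) * (s * q ^ (k - 1)) := by
    obtain ⟨m, rfl⟩ : ∃ m, k = m + 1 := ⟨k - 1, by omega⟩
    have : q ^ (m + 1) - q ^ m = (q - 1) * q ^ m := by
      rw [pow_succ, Nat.sub_mul, one_mul, mul_comm]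
    rw [← hgeom, hn, Nat.add_sub_cancel, this]
    ring
  rw [hdim, hupper,
    ← Finset.sum_erase (a := (0 : C)) Finset.univ (by simp [wt])] at hsum
  have hlow : ∀ y ∈ Finset.univ.erase (0 : C), s * q ^ (k - 1) ≤ wt (y : Fin n → ZMod q) := by
    intro y hy
    exact hwt y y.2 (by simpa using Finset.ne_of_mem_erase hy)
  have hconst : ∑ y ∈ Finset.univ.erase (0 : C), s * q ^ (k - 1) =
      (q ^ k - 1) * (s * q ^ (k - 1)) := by
    rw [Finset.sum_const, Finset.card_erase_of_mem (Finset.mem_univ _), Finset.card_univ, hcard,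
      smul_eq_mul]
  have heq := (Finset.sum_eq_sum_iff_of_le hlow).1
    (le_antisymm (Finset.sum_le_sum hlow) (hconst ▸ hsum))
  exact (heq ⟨x, hx⟩ (Finset.mem_erase.2 ⟨by simpa [Subtype.ext_iff] using hx0,
    Finset.mem_univ _⟩)).symm

end Averaging

lemma sum_mul_eq_zero_of_four_dvd_wt {n : ℕ} {x y : Fin n → ZMod 2} (hx : 4 ∣ wt x)
    (hy : 4 ∣ wt y) (hxy : 4 ∣ wt (x + y)) : ∑ i, x i * y i = 0 := by
  have hwt : wt (x + y) + 2 * wt (x * y) = wt x + wt y := by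
    simp only [wt, Finset.card_filter, Finset.mul_sum, ← Finset.sum_add_distrib, Pi.add_apply,
      Pi.mul_apply]
    refine Finset.sum_congr rfl fun i _ => ?_
    generalize x i = a
    generalize y i = b
    revert a b
    decide
  have hsum : ∑ i, x i * y i = (wt (x * y) : ZMod 2) := by
    simp only [wt, Finset.card_filter, Nat.cast_sum, Pi.mul_apply]
    refine Finset.sum_congr rfl fun i _ => ?_
    generalize x i = a
    generalize y i = b
    revert a b
    decide
  rw [hsum, ZMod.natCast_eq_zero_iff]
  omega

lemma sum_mul_eq_zero_of_three_dvd_wt {n : ℕ} {x y : Fin n → ZMod 3} (hx : 3 ∣ wt x)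
    (hy : 3 ∣ wt y) (hxy : 3 ∣ wt (x + y)) : ∑ i, x i * y i = 0 := by
  have hself : ((wt x + wt y : ℕ) : ZMod 3) + ∑ i, x i * y i * 2 = (wt (x + y) : ZMod 3) := by
    simp only [wt, Finset.card_filter, ← Finset.sum_add_distrib, Nat.cast_sum, Pi.add_apply]
    refine Finset.sum_congr rfl fun i _ => ?_
    generalize x i = a
    generalize y i = b
    revert a b
    decide
  rw [(ZMod.natCast_eq_zero_iff _ _).2 (dvd_add hx hy), (ZMod.natCast_eq_zero_iff _ _).2 hxy,
    zero_add, ← Finset.sum_mul] at hself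
  exact (mul_eq_zero.1 hself).resolve_right (by decide)

lemma not_isLCD_of_sum_mul_eq_zero {R : Type*} [CommRing R] {n : ℕ}
    {C : Submodule R (Fin n → R)} (hC : C ≠ ⊥)
    (h : ∀ x ∈ C, ∀ y ∈ C, ∑ i, x i * y i = 0) : ¬ IsLCD C := by
  intro hLCD
  have hle : C ≤ dualCode C := h
  exact hC ((inf_eq_left.2 hle).symm.trans hLCD)

lemma pow_dvd_wt_of_hasMinWeight_griesmer {q k n : ℕ} [Fact q.Prime] (hk : 0 < k)
    (hdvd : qrep q k ∣ n) {C : Submodule (ZMod q) (Fin n → ZMod q)}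
    (hdim : Module.finrank (ZMod q) C = k) (hC : HasMinWeight C (griesmer q n k)) :
    ∀ x ∈ C, q ^ (k - 1) ∣ wt x := by
  intro x hx
  rcases eq_or_ne x 0 with rfl | hx0
  · simp [wt]
  · obtain ⟨s, hs⟩ := hdvd
    have hle := hs ▸ mul_pow_le_griesmer (Fact.out : q.Prime).pos hk s
    rw [wt_eq_of_le_wt C hk hdim hs (fun y hy hy0 => hle.trans (hC.2 y hy hy0)) hx hx0]
    exact dvd_mul_left _ _

/-- If `(q,k₀) ∈ {(2,3),(3,2)}`, `k ≥ k₀` and `[k]_q ∣ n` (`n > 0`), then there is no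
LCD `[n,k,g_q(n,k)]` code over `𝔽_q`. -/
theorem no_lcd_griesmer {q k₀ k n : ℕ}
    (hq : (q = 2 ∧ k₀ = 3) ∨ (q = 3 ∧ k₀ = 2)) (hk : k₀ ≤ k)
    (hn : 0 < n) (hdvd : qrep q k ∣ n) :
    ¬ ∃ C : Submodule (ZMod q) (Fin n → ZMod q),
      Module.finrank (ZMod q) C = k ∧ IsLCD C ∧ HasMinWeight C (griesmer q n k) := by
  rintro ⟨C, hdim, hLCD, hmin⟩
  have : Fact q.Prime := by
    rcases hq with ⟨rfl, -⟩ | ⟨rfl, -⟩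
    exacts [⟨Nat.prime_two⟩, ⟨Nat.prime_three⟩]
  have hk0 : 0 < k := by omega
  have hC : C ≠ ⊥ := by
    rintro rfl
    rw [finrank_bot] at hdim
    omega
  have hdiv := pow_dvd_wt_of_hasMinWeight_griesmer hk0 hdvd hdim hmin
  refine not_isLCD_of_sum_mul_eq_zero hC (fun x hx y hy => ?_) hLCD
  rcases hq with ⟨rfl, rfl⟩ | ⟨rfl, rfl⟩
  · have hdiv' : ∀ z ∈ C, 4 ∣ wt z := fun z hz =>
      (pow_dvd_pow 2 (by omega : 2 ≤ k - 1)).trans (hdiv z hz)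
    exact sum_mul_eq_zero_of_four_dvd_wt (hdiv' x hx) (hdiv' y hy) (hdiv' _ (C.add_mem hx hy))
  · have hdiv' : ∀ z ∈ C, 3 ∣ wt z := fun z hz =>
      (dvd_pow_self 3 (by omega : k - 1 ≠ 0)).trans (hdiv z hz)
    exact sum_mul_eq_zero_of_three_dvd_wt (hdiv' x hx) (hdiv' y hy) (hdiv' _ (C.add_mem hx hy))
end

section
/- Suppose (q,k₀) ∈ {(2,3),(3,2)}, k ≥ k₀, s is a positive integer and m = (m₁,…,m_{[k]_q}) ∈ ℤ_{≥0}^{[k]_q}. If C_{q,k}(m) is an LCD [Σᵢ mᵢ, k, d₀] code over 𝔽_q, then the code with generator matrix (S_{q,k}^{(s)} | G_{q,k}(m)) is an LCD [n,k,d] code over 𝔽_q, where n = Σᵢ mᵢ + [k]_q·s and d = d₀ + q^{k−1}·s. -/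
open Matrix Finset

/-- Summing a function of remainder and quotient over `range (r * s)`. -/
lemma sum_range_mul_mod_div {A : Type*} [AddCommMonoid A] (r s : ℕ) (f : ℕ → ℕ → A) :
    ∑ t ∈ range (r * s), f (t % r) (t / r) = ∑ c ∈ range s, ∑ i ∈ range r, f i c := by
  induction s with
  | zero => simp
  | succ s ih =>
    rw [Nat.mul_succ, Finset.sum_range_add, ih, Finset.sum_range_succ]
    congr 1
    refine Finset.sum_congr rfl fun i hi => ?_
    have hi := Finset.mem_range.1 hi
    rw [Nat.mul_add_mod, Nat.mod_eq_of_lt hi, Nat.mul_add_div (by omega), Nat.div_eq_of_lt hi,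
      add_zero]

lemma qrep_succ (q k : ℕ) : qrep q (k + 1) = q * qrep q k + 1 :=
  geom_sum_succ

lemma qrep_mul_pred_add_one (p k : ℕ) : p * qrep (p + 1) k + 1 = (p + 1) ^ k := by
  induction k with
  | zero => simp [qrep]
  | succ k ih => rw [qrep_succ, pow_succ, ← ih]; ring

/-- The recursive structure of the simplex matrix, in terms of sums over its columns. -/
lemma sum_simplexCol_succ {A : Type*} [AddCommMonoid A] (p k : ℕ)
    (g : (Fin (k + 1) → ZMod (p + 1)) → A) :
    ∑ j ∈ range (qrep (p + 1) (k + 1)), g (simplexCol (p + 1) (k + 1) j) =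
      (∑ c ∈ range (p + 1), ∑ j ∈ range (qrep (p + 1) k),
        g (Fin.snoc (α := fun _ => ZMod (p + 1)) (simplexCol (p + 1) k j) (c : ZMod (p + 1)))) +
      g (Fin.snoc (α := fun _ => ZMod (p + 1)) (fun _ => 0) 1) := by
  have hr : qrep (p + 1) (k + 1) = qrep (p + 1) k + 1 + qrep (p + 1) k * p := by
    rw [qrep_succ]; ring
  rw [hr, Finset.sum_range_add, Finset.sum_range_succ, Finset.sum_range_succ' (n := p),
    ← sum_range_mul_mod_div _ p fun i c => g (Fin.snoc (α := fun _ => ZMod (p + 1))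
      (simplexCol (p + 1) k i) ((c + 1 : ℕ) : ZMod (p + 1)))]
  have h₁ : ∑ j ∈ range (qrep (p + 1) k), g (simplexCol (p + 1) (k + 1) j) =
      ∑ j ∈ range (qrep (p + 1) k), g (Fin.snoc (α := fun _ => ZMod (p + 1))
        (simplexCol (p + 1) k j) ((0 : ℕ) : ZMod (p + 1))) := by
    refine Finset.sum_congr rfl fun j hj => ?_
    rw [simplexCol, if_pos (Finset.mem_range.1 hj), Nat.cast_zero]
  have h₂ : simplexCol (p + 1) (k + 1) (qrep (p + 1) k) =
      Fin.snoc (α := fun _ => ZMod (p + 1)) (fun _ => 0) 1 := by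
    rw [simplexCol, if_neg (lt_irrefl _), if_pos rfl]
  have h₃ : ∀ t, simplexCol (p + 1) (k + 1) (qrep (p + 1) k + 1 + t) =
      Fin.snoc (α := fun _ => ZMod (p + 1)) (simplexCol (p + 1) k (t % qrep (p + 1) k))
        ((t / qrep (p + 1) k + 1 : ℕ) : ZMod (p + 1)) := by
    intro t
    rw [simplexCol, if_neg (by omega), if_neg (by omega),
      show qrep (p + 1) k + 1 + t - qrep (p + 1) k - 1 = t by omega]
  simp only [h₁, h₂, h₃]
  abel

lemma dotProduct_snoc {R : Type*} [CommRing R] {k : ℕ} (v : Fin (k + 1) → R) (h : Fin k → R)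
    (c : R) : v ⬝ᵥ (Fin.snoc (α := fun _ => R) h c) =
      (Fin.init (α := fun _ => R) v) ⬝ᵥ h + v (Fin.last k) * c := by
  simp [dotProduct, Fin.sum_univ_castSucc, Fin.init]

lemma card_ne_zero_of_two : ∀ x a : ZMod 2, a ≠ 0 →
    ∑ c ∈ range 2, (if x + a * (c : ZMod 2) ≠ 0 then 1 else 0) = 1 := by
  simp only [Finset.sum_range_succ, Finset.sum_range_zero]
  decide

lemma card_ne_zero_of_three : ∀ x a : ZMod 3, a ≠ 0 →
    ∑ c ∈ range 3, (if x + a * (c : ZMod 3) ≠ 0 then 1 else 0) = 2 := by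
  simp only [Finset.sum_range_succ, Finset.sum_range_zero]
  decide

/-- Every nonzero codeword of the simplex code has weight `q ^ (k - 1)`. -/
lemma simplex_weight (p : ℕ) (hp : ∀ x a : ZMod (p + 1), a ≠ 0 →
      ∑ c ∈ range (p + 1), (if x + a * (c : ZMod (p + 1)) ≠ 0 then 1 else 0) = p)
    (k : ℕ) (v : Fin k → ZMod (p + 1)) (hv : v ≠ 0) :
    ∑ j ∈ range (qrep (p + 1) k), (if v ⬝ᵥ simplexCol (p + 1) k j ≠ 0 then 1 else 0) =
      (p + 1) ^ (k - 1) := by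
  induction k with
  | zero => exact absurd (Subsingleton.elim _ _) hv
  | succ k ih =>
    rw [sum_simplexCol_succ p k fun h => if v ⬝ᵥ h ≠ 0 then 1 else 0]
    have h0 : (Fin.init (α := fun _ => ZMod (p + 1)) v) ⬝ᵥ (fun _ => 0) = 0 :=
      dotProduct_zero _
    simp only [dotProduct_snoc, h0, zero_add, mul_one]
    by_cases ha : v (Fin.last k) = 0
    · have hu : Fin.init (α := fun _ => ZMod (p + 1)) v ≠ 0 := by
        intro hu
        refine hv (funext fun i => ?_)
        induction i using Fin.lastCases with
        | last => exact ha
        | cast i => exact congrFun hu i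
      cases k with
      | zero => exact absurd (Subsingleton.elim _ _) hu
      | succ k =>
        simp only [ha, zero_mul, add_zero]
        rw [ih _ hu]
        simp [pow_succ, mul_comm]
    · rw [Finset.sum_comm]
      simp only [hp _ _ ha]
      simp [ha, ← qrep_mul_pred_add_one p k, mul_comm]

lemma qrep_two_cast_add_one (k : ℕ) (hk : 1 ≤ k) : (qrep 2 k : ZMod 2) + 1 = 0 := by
  have h := congrArg (Nat.cast : ℕ → ZMod 2) (qrep_mul_pred_add_one 1 k)
  push_cast at h
  rw [one_mul] at h
  rw [h, show (2 : ZMod 2) = 0 from by decide, zero_pow (by omega)]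

lemma two_mul_qrep_three_cast_add_one (k : ℕ) (hk : 1 ≤ k) :
    2 * (qrep 3 k : ZMod 3) + 1 = 0 := by
  have h := congrArg (Nat.cast : ℕ → ZMod 3) (qrep_mul_pred_add_one 2 k)
  push_cast at h
  rw [h, show (3 : ZMod 3) = 0 from by decide, zero_pow (by omega)]

lemma sum_dotProduct_simplexCol_two (k : ℕ) (hk : 2 ≤ k) (v : Fin k → ZMod 2) :
    ∑ j ∈ range (qrep 2 k), v ⬝ᵥ simplexCol 2 k j = 0 := by
  obtain ⟨k, rfl⟩ := Nat.exists_eq_add_of_le' (show 1 ≤ k by omega)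
  rw [sum_simplexCol_succ 1 k fun h => v ⬝ᵥ h]
  have h0 : (Fin.init (α := fun _ => ZMod 2) v) ⬝ᵥ (fun _ => 0) = 0 := dotProduct_zero _
  have key : ∀ x a : ZMod 2, ∑ c ∈ range 2, (x + a * (c : ZMod 2)) = a := by
    simp only [Finset.sum_range_succ, Finset.sum_range_zero]
    decide
  rw [Finset.sum_comm]
  simp only [dotProduct_snoc, h0, key, one_add_one_eq_two]
  simp only [Finset.sum_const, Finset.card_range, nsmul_eq_mul]
  linear_combination v (Fin.last k) * qrep_two_cast_add_one k (by omega)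

/-- The binary simplex code of dimension at least three is self-orthogonal. -/
lemma simplex_self_orthogonal_two (k : ℕ) (hk : 3 ≤ k) (v w : Fin k → ZMod 2) :
    ∑ j ∈ range (qrep 2 k), (v ⬝ᵥ simplexCol 2 k j) * (w ⬝ᵥ simplexCol 2 k j) = 0 := by
  obtain ⟨k, rfl⟩ := Nat.exists_eq_add_of_le' (show 1 ≤ k by omega)
  rw [sum_simplexCol_succ 1 k fun h => (v ⬝ᵥ h) * (w ⬝ᵥ h)]
  have h0 : ∀ u : Fin k → ZMod 2, u ⬝ᵥ (fun _ => 0) = 0 := dotProduct_zero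
  have key : ∀ x a y b : ZMod 2,
      ∑ c ∈ range 2, (x + a * (c : ZMod 2)) * (y + b * (c : ZMod 2)) = a * y + b * x + a * b := by
    simp only [Finset.sum_range_succ, Finset.sum_range_zero]
    decide
  rw [Finset.sum_comm]
  simp only [dotProduct_snoc, h0, key, one_add_one_eq_two]
  simp only [Finset.sum_add_distrib, ← Finset.mul_sum,
    sum_dotProduct_simplexCol_two k (by omega), Finset.sum_const, Finset.card_range, nsmul_eq_mul]
  linear_combination v (Fin.last k) * w (Fin.last k) * qrep_two_cast_add_one k (by omega)

/-- The ternary simplex code of dimension at least two is self-orthogonal. -/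
lemma simplex_self_orthogonal_three (k : ℕ) (hk : 2 ≤ k) (v w : Fin k → ZMod 3) :
    ∑ j ∈ range (qrep 3 k), (v ⬝ᵥ simplexCol 3 k j) * (w ⬝ᵥ simplexCol 3 k j) = 0 := by
  obtain ⟨k, rfl⟩ := Nat.exists_eq_add_of_le' (show 1 ≤ k by omega)
  rw [sum_simplexCol_succ 2 k fun h => (v ⬝ᵥ h) * (w ⬝ᵥ h)]
  have h0 : ∀ u : Fin k → ZMod 3, u ⬝ᵥ (fun _ => 0) = 0 := dotProduct_zero
  have key : ∀ x a y b : ZMod 3,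
      ∑ c ∈ range 3, (x + a * (c : ZMod 3)) * (y + b * (c : ZMod 3)) = 2 * (a * b) := by
    simp only [Finset.sum_range_succ, Finset.sum_range_zero]
    decide
  rw [Finset.sum_comm]
  simp only [dotProduct_snoc, h0, key, two_add_one_eq_three]
  simp only [Finset.sum_const, Finset.card_range, nsmul_eq_mul]
  linear_combination v (Fin.last k) * w (Fin.last k) *
    two_mul_qrep_three_cast_add_one k (by omega)

lemma sum_hcat_reps_simplex {A : Type*} [AddCommMonoid A] {q k n : ℕ} (s : ℕ)
    (G : Matrix (Fin k) (Fin n) (ZMod q)) (g : (Fin k → ZMod q) → A) :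
    ∑ j, g ((hcat (reps (simplexMatrix q k) s) G).col j) =
      s • ∑ j ∈ range (qrep q k), g (simplexCol q k j) + ∑ j, g (G.col j) := by
  rw [Fin.sum_univ_add]
  congr 1
  · have h : ∀ j : Fin (qrep q k * s),
        g ((hcat (reps (simplexMatrix q k) s) G).col (Fin.castAdd n j)) =
          g (simplexCol q k (j % qrep q k)) := by
      intro j
      congr 1
      ext i
      simp [hcat, reps, simplexMatrix, Matrix.col]
    rw [Finset.sum_congr rfl fun j _ => h j,
      Fin.sum_univ_eq_sum_range fun t => g (simplexCol q k (t % qrep q k)),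
      sum_range_mul_mod_div _ s fun i _ => g (simplexCol q k i)]
    simp
  · refine Finset.sum_congr rfl fun j _ => ?_
    congr 1
    ext i
    simp [hcat, Matrix.col]

lemma rowSpace_eq_range {R : Type*} [CommRing R] {k n : ℕ} (G : Matrix (Fin k) (Fin n) R) :
    rowSpace G = LinearMap.range G.vecMulLinear :=
  (range_vecMulLinear G).symm

lemma mem_rowSpace {R : Type*} [CommRing R] {k n : ℕ} {G : Matrix (Fin k) (Fin n) R}
    {x : Fin n → R} : x ∈ rowSpace G ↔ ∃ v, v ᵥ* G = x := by
  rw [rowSpace_eq_range]; rfl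

lemma finrank_rowSpace_eq_iff {F : Type*} [Field F] {k n : ℕ} (G : Matrix (Fin k) (Fin n) F) :
    Module.finrank F (rowSpace G) = k ↔ ∀ v, v ᵥ* G = 0 → v = 0 := by
  rw [rowSpace_eq_range]
  have h := LinearMap.finrank_range_add_finrank_ker G.vecMulLinear
  rw [Module.finrank_fin_fun] at h
  have h' : (∀ v, v ᵥ* G = 0 → v = 0) ↔ LinearMap.ker G.vecMulLinear = ⊥ :=
    (LinearMap.ker_eq_bot' (f := G.vecMulLinear)).symm
  rw [h', ← Submodule.finrank_eq_zero (R := F)]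
  omega

lemma wt_eq_zero {R : Type*} [Zero R] [DecidableEq R] {n : ℕ} {x : Fin n → R} :
    wt x = 0 ↔ x = 0 := by
  simp [wt, Finset.filter_eq_empty_iff, funext_iff]

lemma wt_vecMul {R : Type*} [CommRing R] [DecidableEq R] {k n : ℕ} (v : Fin k → R)
    (G : Matrix (Fin k) (Fin n) R) :
    wt (v ᵥ* G) = ∑ j, if v ⬝ᵥ G.col j ≠ 0 then 1 else 0 :=
  Finset.card_filter _ _

/-- Juxtaposing copies of a self-orthogonal simplex code preserves the LCD property and the
dimension, and shifts the minimum weight. -/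
lemma juxtapose_simplex {q k n s d₀ : ℕ} [Fact q.Prime] (G : Matrix (Fin k) (Fin n) (ZMod q))
    (hwt : ∀ v : Fin k → ZMod q, v ≠ 0 → ∑ j ∈ range (qrep q k),
      (if v ⬝ᵥ simplexCol q k j ≠ 0 then 1 else 0) = q ^ (k - 1))
    (hso : ∀ v w : Fin k → ZMod q, ∑ j ∈ range (qrep q k),
      (v ⬝ᵥ simplexCol q k j) * (w ⬝ᵥ simplexCol q k j) = 0)
    (hfin : Module.finrank (ZMod q) (rowSpace G) = k)
    (hlcd : IsLCD (rowSpace G)) (hmw : HasMinWeight (rowSpace G) d₀) :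
    Module.finrank (ZMod q) (rowSpace (hcat (reps (simplexMatrix q k) s) G)) = k ∧
    IsLCD (rowSpace (hcat (reps (simplexMatrix q k) s) G)) ∧
    HasMinWeight (rowSpace (hcat (reps (simplexMatrix q k) s) G)) (d₀ + q ^ (k - 1) * s) := by
  rw [finrank_rowSpace_eq_iff] at hfin ⊢
  set H := hcat (reps (simplexMatrix q k) s) G with hH
  have hw : ∀ v, v ≠ 0 → wt (v ᵥ* H) = wt (v ᵥ* G) + q ^ (k - 1) * s := by
    intro v hv
    rw [wt_vecMul, wt_vecMul, hH,
      sum_hcat_reps_simplex s G fun h => if v ⬝ᵥ h ≠ 0 then 1 else 0, hwt v hv, smul_eq_mul]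
    ring
  have hip : ∀ v w, ∑ j, (v ᵥ* H) j * (w ᵥ* H) j = ∑ j, (v ᵥ* G) j * (w ᵥ* G) j := by
    intro v w
    have := sum_hcat_reps_simplex s G fun h => (v ⬝ᵥ h) * (w ⬝ᵥ h)
    rw [hso v w, smul_zero, zero_add] at this
    exact this
  have hinj : ∀ v, v ᵥ* H = 0 → v = 0 := by
    intro v hv
    by_contra hne
    have h := hw v hne
    rw [wt_eq_zero.2 hv] at h
    exact hne (hfin v (wt_eq_zero.1 (by omega)))
  refine ⟨hinj, ?_, ?_, ?_⟩
  · refine (Submodule.eq_bot_iff _).2 ?_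
    rintro x ⟨hx, hxd⟩
    obtain ⟨v, rfl⟩ := mem_rowSpace.1 hx
    have hG : v ᵥ* G ∈ rowSpace G ⊓ dualCode (rowSpace G) := by
      refine ⟨mem_rowSpace.2 ⟨v, rfl⟩, fun y hy => ?_⟩
      obtain ⟨w, rfl⟩ := mem_rowSpace.1 hy
      rw [← hip]
      exact hxd _ (mem_rowSpace.2 ⟨w, rfl⟩)
    have h0 := (Submodule.eq_bot_iff _).1 hlcd _ hG
    rw [hfin v h0, Matrix.zero_vecMul]
  · obtain ⟨⟨x, hx, hx0, rfl⟩, -⟩ := hmw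
    obtain ⟨v, rfl⟩ := mem_rowSpace.1 hx
    have hv : v ≠ 0 := by
      rintro rfl
      exact hx0 (Matrix.zero_vecMul _)
    exact ⟨_, mem_rowSpace.2 ⟨v, rfl⟩, fun h => hv (hinj v h), hw v hv⟩
  · intro x hx hx0
    obtain ⟨v, rfl⟩ := mem_rowSpace.1 hx
    have hv : v ≠ 0 := by
      rintro rfl
      exact hx0 (Matrix.zero_vecMul _)
    rw [hw v hv]
    exact Nat.add_le_add_right
      (hmw.2 _ (mem_rowSpace.2 ⟨v, rfl⟩) fun h => hv (hfin v h)) _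

/-- If `C_{q,k}(m)` is an LCD `[∑ mᵢ, k, d₀]` code, then the code with generator matrix
`(S_{q,k}^{(s)} | G_{q,k}(m))` is an LCD `[∑ mᵢ + [k]_q·s, k, d₀ + q^{k-1}·s]` code. -/
theorem lcd_juxtapose_simplex {q k₀ k s d₀ : ℕ}
    (hq : (q = 2 ∧ k₀ = 3) ∨ (q = 3 ∧ k₀ = 2)) (hk : k₀ ≤ k) (hs : 1 ≤ s)
    (m : Fin (qrep q k) → ℕ)
    (hfin : Module.finrank (ZMod q) (rowSpace (Gqk q k m)) = k)
    (hlcd : IsLCD (rowSpace (Gqk q k m)))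
    (hmw : HasMinWeight (rowSpace (Gqk q k m)) d₀) :
    Module.finrank (ZMod q) (rowSpace (hcat (reps (simplexMatrix q k) s) (Gqk q k m))) = k ∧
    IsLCD (rowSpace (hcat (reps (simplexMatrix q k) s) (Gqk q k m))) ∧
    HasMinWeight (rowSpace (hcat (reps (simplexMatrix q k) s) (Gqk q k m)))
      (d₀ + q ^ (k - 1) * s) := by
  obtain ⟨rfl, rfl⟩ | ⟨rfl, rfl⟩ := hq
  · exact juxtapose_simplex _ (simplex_weight 1 card_ne_zero_of_two k)
      (simplex_self_orthogonal_two k hk) hfin hlcd hmw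
  · exact juxtapose_simplex _ (simplex_weight 2 card_ne_zero_of_three k)
      (simplex_self_orthogonal_three k hk) hfin hlcd hmw
end

section
/- Suppose (q,k₀) ∈ {(2,3),(3,2)}, k ≥ k₀ and q·d − (q−1)·n ≥ 1. Let r_{q,n,k,d} = q^{k−1}·n − [k]_q·d. If q·r_{q,n,k,d} < k, then there is no LCD [n,k,d] code over 𝔽_q with dual distance d⊥ ≥ 2. -/
open Matrix Finset

section ConstantWeight

variable {F : Type*} [Field F] {n : ℕ}

/-- The evaluation of the `i`-th coordinate on a code. -/
def coordEval (C : Submodule F (Fin n → F)) (i : Fin n) : C →ₗ[F] F :=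
  (LinearMap.proj i).comp C.subtype

lemma coordEval_apply (C : Submodule F (Fin n → F)) (i : Fin n) (c : C) :
    coordEval C i c = (c : Fin n → F) i := rfl

lemma card_ker_eq_pow [Fintype F] {V W : Type*} [AddCommGroup V] [Module F V] [Fintype V]
    [AddCommGroup W] [Module F W] [DecidableEq W] (f : V →ₗ[F] W) :
    (univ.filter fun v => f v = 0).card =
      Fintype.card F ^ Module.finrank F (LinearMap.ker f) := by
  classical
  have h := Module.card_eq_pow_finrank (K := F) (V := LinearMap.ker f)
  rw [← h, Fintype.card_subtype]
  simp

variable [DecidableEq F]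

lemma wt_cast (x : Fin n → F) : (wt x : ℤ) = ∑ i, if x i ≠ 0 then 1 else 0 := by
  rw [Finset.sum_boole, wt]

lemma exists_coord_ne_zero {C : Submodule F (Fin n → F)} (hC : DualDistGe C 2) (i : Fin n) :
    ∃ c : C, (c : Fin n → F) i ≠ 0 := by
  by_contra! h
  have hmem : (Pi.single i 1 : Fin n → F) ∈ dualCode C := by
    intro y hy
    simpa [Pi.single_apply] using h ⟨y, hy⟩
  have h2 := hC _ hmem (by simp)
  have h1 : wt (Pi.single i 1 : Fin n → F) = 1 := by
    rw [wt, Finset.card_eq_one]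
    exact ⟨i, by ext j; simp [Pi.single_apply]⟩
  omega

lemma coordEval_ne_zero {C : Submodule F (Fin n → F)} (hC : DualDistGe C 2)
    (i : Fin n) : coordEval C i ≠ 0 := by
  obtain ⟨c, hc⟩ := exists_coord_ne_zero hC i
  intro h
  exact hc (by simpa [coordEval_apply] using LinearMap.congr_fun h c)

variable [Fintype F]

lemma card_coord_eq_zero {V : Type*} [AddCommGroup V] [Module F V] [Fintype V]
    (f : V →ₗ[F] F) (hf : f ≠ 0) :
    (univ.filter fun v => f v = 0).card = Fintype.card F ^ (Module.finrank F V - 1) := by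
  rw [card_ker_eq_pow]
  have h := f.finrank_range_add_finrank_ker
  rw [LinearMap.range_eq_top.2 (LinearMap.surjective hf), finrank_top,
    Module.finrank_self] at h
  congr 1
  omega

lemma card_coords_eq_zero_dvd {V : Type*} [AddCommGroup V] [Module F V] [Fintype V]
    (f g : V →ₗ[F] F) :
    Fintype.card F ^ (Module.finrank F V - 2) ∣
      (univ.filter fun v => f v = 0 ∧ g v = 0).card := by
  have h := card_ker_eq_pow (f.prod g)
  simp only [LinearMap.prod_apply, Function.prod_apply, Prod.mk_eq_zero] at h
  rw [h]
  apply pow_dvd_pow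
  have h1 := (f.prod g).finrank_range_add_finrank_ker
  have h2 := Submodule.finrank_le (LinearMap.range (f.prod g))
  rw [Module.finrank_prod, Module.finrank_self] at h2
  omega

variable {C : Submodule F (Fin n → F)} [Fintype C]

lemma sum_coord_ne_zero (hC : DualDistGe C 2) (i : Fin n) :
    (∑ c : C, if (c : Fin n → F) i ≠ 0 then 1 else 0 : ℤ) =
      (Fintype.card F : ℤ) ^ Module.finrank F C -
        (Fintype.card F : ℤ) ^ (Module.finrank F C - 1) := by
  have h0 := card_coord_eq_zero (coordEval C i) (coordEval_ne_zero hC i)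
  have h1 := Finset.card_filter_add_card_filter_not (s := (univ : Finset C))
    (fun c => coordEval C i c = 0)
  rw [h0, Finset.card_univ, Module.card_eq_pow_finrank (K := F) (V := C)] at h1
  simp only [coordEval_apply] at h1
  rw [Finset.sum_boole]
  have h2 := congrArg (Nat.cast : ℕ → ℤ) h1
  push_cast at h2
  exact eq_sub_of_add_eq' h2

lemma sum_wt (hC : DualDistGe C 2) :
    ∑ c : C, (wt (c : Fin n → F) : ℤ) =
      n * ((Fintype.card F : ℤ) ^ Module.finrank F C -
        (Fintype.card F : ℤ) ^ (Module.finrank F C - 1)) := by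
  simp only [wt_cast]
  rw [Finset.sum_comm]
  simp only [sum_coord_ne_zero hC]
  simp [mul_sub]

lemma dvd_sum_coords_ne_zero (hC : DualDistGe C 2) (i j : Fin n) :
    (Fintype.card F : ℤ) ^ (Module.finrank F C - 2) ∣
      ∑ c : C, if (c : Fin n → F) i ≠ 0 ∧ (c : Fin n → F) j ≠ 0 then 1 else 0 := by
  have key : ∀ c : C,
      (if (c : Fin n → F) i ≠ 0 ∧ (c : Fin n → F) j ≠ 0 then 1 else 0 : ℤ) =
      (if (c : Fin n → F) i ≠ 0 then 1 else 0) + (if (c : Fin n → F) j ≠ 0 then 1 else 0) - 1 +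
        (if coordEval C i c = 0 ∧ coordEval C j c = 0 then 1 else 0) := by
    intro c
    simp only [coordEval_apply]
    by_cases h1 : (c : Fin n → F) i = 0 <;> by_cases h2 : (c : Fin n → F) j = 0 <;>
      simp [h1, h2]
  simp only [key, Finset.sum_add_distrib, Finset.sum_sub_distrib, sum_coord_ne_zero hC]
  have hp1 : (Fintype.card F : ℤ) ^ (Module.finrank F C - 2) ∣
      (Fintype.card F : ℤ) ^ Module.finrank F C := pow_dvd_pow _ (by omega)
  have hp2 : (Fintype.card F : ℤ) ^ (Module.finrank F C - 2) ∣
      (Fintype.card F : ℤ) ^ (Module.finrank F C - 1) := pow_dvd_pow _ (by omega)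
  have hp3 := card_coords_eq_zero_dvd (coordEval C i) (coordEval C j)
  refine dvd_add (dvd_sub (dvd_add (dvd_sub hp1 hp2) (dvd_sub hp1 hp2)) ?_) ?_
  · rw [Finset.sum_const, Finset.card_univ, Module.card_eq_pow_finrank (K := F) (V := C)]
    simpa using hp1
  · rw [Finset.sum_boole]
    exact_mod_cast hp3

/-- The excess weight of the codewords not vanishing at `i` is highly divisible. -/
lemma dvd_sum_excess (hC : DualDistGe C 2) (d : ℕ) (i : Fin n) :
    (Fintype.card F : ℤ) ^ (Module.finrank F C - 2) ∣
      ∑ c : C, if (c : Fin n → F) i ≠ 0 then (wt (c : Fin n → F) : ℤ) - d else 0 := by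
  have key : ∀ c : C,
      (if (c : Fin n → F) i ≠ 0 then (wt (c : Fin n → F) : ℤ) - d else 0) =
      (∑ j, if (c : Fin n → F) i ≠ 0 ∧ (c : Fin n → F) j ≠ 0 then 1 else 0) -
        d * (if (c : Fin n → F) i ≠ 0 then 1 else 0) := by
    intro c
    rw [wt_cast]
    by_cases h : (c : Fin n → F) i = 0 <;> simp [h]
  simp only [key, Finset.sum_sub_distrib, ← Finset.mul_sum, sum_coord_ne_zero hC]
  rw [Finset.sum_comm]
  refine dvd_sub (Finset.dvd_sum fun j _ => dvd_sum_coords_ne_zero hC i j)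
    (Dvd.dvd.mul_left (dvd_sub ?_ ?_) _) <;> exact pow_dvd_pow _ (by omega)

lemma sum_excess (hC : DualDistGe C 2) (hk : 1 ≤ Module.finrank F C) (d : ℕ) :
    ∑ c : C, (if c ≠ 0 then (wt (c : Fin n → F) : ℤ) - d else 0) =
      ((Fintype.card F : ℤ) - 1) * ((Fintype.card F : ℤ) ^ (Module.finrank F C - 1) * n -
        (qrep (Fintype.card F) (Module.finrank F C) : ℤ) * d) := by
  have key : ∀ c : C, (if c ≠ 0 then (wt (c : Fin n → F) : ℤ) - d else 0) =
      wt (c : Fin n → F) - d + if c = 0 then (d : ℤ) else 0 := by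
    intro c
    by_cases h : c = 0
    · simp [h, wt]
    · simp [h]
  simp only [key, Finset.sum_add_distrib, Finset.sum_sub_distrib, sum_wt hC]
  have hg : (qrep (Fintype.card F) (Module.finrank F C) : ℤ) * ((Fintype.card F : ℤ) - 1) =
      (Fintype.card F : ℤ) ^ Module.finrank F C - 1 := by
    rw [← geom_sum_mul]
    simp [qrep]
  have hpow : (Fintype.card F : ℤ) ^ Module.finrank F C =
      (Fintype.card F : ℤ) ^ (Module.finrank F C - 1) * Fintype.card F := by
    rw [← pow_succ]
    congr 1
    omega
  rw [Finset.sum_const, Finset.card_univ, Module.card_eq_pow_finrank (K := F) (V := C)]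
  simp only [Finset.sum_ite_eq', Finset.mem_univ, if_true, nsmul_eq_mul, Nat.cast_pow]
  linear_combination (n : ℤ) * hpow + (d : ℤ) * hg

/-- A code with small total excess weight has constant weight. -/
lemma wt_eq_of_card_mul_lt (hC : DualDistGe C 2) (hk : 2 ≤ Module.finrank F C) {d : ℕ}
    (hd : ∀ x ∈ C, x ≠ 0 → d ≤ wt x)
    (hr : (Fintype.card F : ℤ) * ((Fintype.card F : ℤ) ^ (Module.finrank F C - 1) * n -
      (qrep (Fintype.card F) (Module.finrank F C) : ℤ) * d) < Module.finrank F C) :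
    ∀ x ∈ C, x ≠ 0 → wt x = d := by
  intro x hx hx0
  obtain ⟨i, hi⟩ := Function.ne_iff.1 hx0
  have hpos : ∀ c : C, 0 ≤ if (c : Fin n → F) i ≠ 0 then (wt (c : Fin n → F) : ℤ) - d else 0 := by
    intro c
    split_ifs with h
    · have := hd c c.2 (by rintro h'; simp [h'] at h)
      omega
    · rfl
  have hle : (∑ c : C, if (c : Fin n → F) i ≠ 0 then (wt (c : Fin n → F) : ℤ) - d else 0) ≤
      ∑ c : C, if c ≠ 0 then (wt (c : Fin n → F) : ℤ) - d else 0 := by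
    refine Finset.sum_le_sum fun c _ => ?_
    by_cases h : c = 0
    · simp [h]
    · have := hd c c.2 (by simpa using h)
      by_cases h' : (c : Fin n → F) i = 0
      · simpa [h, h'] using this
      · simp [h, h']
  rw [sum_excess hC (by omega)] at hle
  set q : ℤ := (Fintype.card F : ℤ) with hq
  set k := Module.finrank F C
  set r := q ^ (k - 1) * n - (qrep (Fintype.card F) k : ℤ) * d
  have hq2 : 2 ≤ q := by
    rw [hq]
    exact_mod_cast Fintype.one_lt_card (α := F)
  have hb : 1 + ((k - 1 : ℕ) : ℤ) * (q - 1) ≤ q ^ (k - 1) := by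
    simpa using one_add_mul_le_pow (show (-2 : ℤ) ≤ q - 1 by omega) (k - 1)
  have hk1 : ((k - 1 : ℕ) : ℤ) = k - 1 := by omega
  have hpow : q ^ (k - 1) = q * q ^ (k - 2) := by
    rw [← pow_succ']
    congr 1
    omega
  have hlt : (q - 1) * r < q ^ (k - 2) := by
    have h1 : (q - 1) * (q * r) ≤ (q - 1) * (k - 1) :=
      mul_le_mul_of_nonneg_left (by omega) (by omega)
    rw [hk1, hpow] at hb
    refine lt_of_mul_lt_mul_left (a := q) ?_ (by omega)
    linarith
  have hzero := Int.eq_zero_of_dvd_of_nonneg_of_lt (Finset.sum_nonneg fun c _ => hpos c)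
    (hle.trans_lt hlt) (dvd_sum_excess hC d i)
  have h := (Finset.sum_eq_zero_iff_of_nonneg fun c _ => hpos c).1 hzero ⟨x, hx⟩
    (Finset.mem_univ _)
  rw [if_pos (by exact hi)] at h
  simp only at h
  omega

lemma card_pow_dvd_of_wt_eq (hC : DualDistGe C 2) (hk : 1 ≤ Module.finrank F C) {d : ℕ}
    (hd : ∀ x ∈ C, x ≠ 0 → wt x = d) :
    Fintype.card F ^ (Module.finrank F C - 1) ∣ d := by
  have h := sum_excess hC hk d
  rw [Finset.sum_eq_zero] at h
  · have hq : (1 : ℤ) < Fintype.card F := by exact_mod_cast Fintype.one_lt_card (α := F)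
    have h' := (mul_eq_zero.1 h.symm).resolve_left (by omega)
    have h'' : qrep (Fintype.card F) (Module.finrank F C) * d =
        Fintype.card F ^ (Module.finrank F C - 1) * n := by
      zify
      linarith
    refine Nat.Coprime.dvd_of_dvd_mul_left (Nat.Coprime.pow_left _ ?_) ⟨n, h''⟩
    obtain ⟨m, hm⟩ := Nat.exists_eq_add_of_le' hk
    rw [hm, qrep, Finset.sum_range_succ']
    simp [pow_succ, ← Finset.sum_mul]
  · intro c _
    split_ifs with h0
    · simp [hd c c.2 (by simpa using h0)]
    · rfl

end ConstantWeight

lemma not_isLCD_of_dot_eq_zero {R : Type*} [CommRing R] {n : ℕ} {C : Submodule R (Fin n → R)}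
    (h : ∀ x ∈ C, ∀ y ∈ C, ∑ i, x i * y i = 0) (hC : C ≠ ⊥) : ¬ IsLCD C := by
  intro hL
  refine hC (eq_bot_iff.2 fun x hx => ?_)
  rw [← hL]
  exact ⟨hx, h x hx⟩

lemma wt_cast_zmod_three {n : ℕ} (x : Fin n → ZMod 3) :
    (wt x : ZMod 3) = ∑ i, x i * x i := by
  rw [wt, Finset.card_eq_sum_ones, Finset.sum_filter]
  push_cast
  refine Finset.sum_congr rfl fun i _ => ?_
  generalize x i = a
  revert a
  decide

lemma dot_eq_zero_of_three_dvd_wt {n : ℕ} {C : Submodule (ZMod 3) (Fin n → ZMod 3)}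
    (h : ∀ x ∈ C, 3 ∣ wt x) (x : Fin n → ZMod 3) (hx : x ∈ C) (y : Fin n → ZMod 3) (hy : y ∈ C) :
    ∑ i, x i * y i = 0 := by
  have h0 : ∀ z ∈ C, ∑ i, z i * z i = 0 := fun z hz => by
    rw [← wt_cast_zmod_three, ZMod.natCast_eq_zero_iff]
    exact h z hz
  have hxy := h0 _ (C.add_mem hx hy)
  have : ∑ i, (x + y) i * (x + y) i =
      (∑ i, x i * x i) + (∑ i, y i * y i) + 2 * ∑ i, x i * y i := by
    rw [Finset.mul_sum, ← Finset.sum_add_distrib, ← Finset.sum_add_distrib]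
    exact Finset.sum_congr rfl fun i _ => by simp only [Pi.add_apply]; ring
  rw [this, h0 x hx, h0 y hy, zero_add, zero_add] at hxy
  exact (mul_eq_zero.1 hxy).resolve_left (by decide)

lemma wt_add_zmod_two {n : ℕ} (x y : Fin n → ZMod 2) :
    wt (x + y) + 2 * (univ.filter fun i => x i * y i ≠ 0).card = wt x + wt y := by
  simp only [wt, Finset.card_eq_sum_ones, Finset.sum_filter, Finset.mul_sum,
    ← Finset.sum_add_distrib]
  refine Finset.sum_congr rfl fun i _ => ?_
  rw [Pi.add_apply]
  generalize x i = a
  generalize y i = b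
  revert a b
  decide

lemma dot_eq_zero_of_four_dvd_wt {n : ℕ} {C : Submodule (ZMod 2) (Fin n → ZMod 2)}
    (h : ∀ x ∈ C, 4 ∣ wt x) (x : Fin n → ZMod 2) (hx : x ∈ C) (y : Fin n → ZMod 2) (hy : y ∈ C) :
    ∑ i, x i * y i = 0 := by
  have hc : (((univ.filter fun i => x i * y i ≠ 0).card : ℕ) : ZMod 2) = ∑ i, x i * y i := by
    rw [Finset.card_eq_sum_ones, Finset.sum_filter]
    push_cast
    refine Finset.sum_congr rfl fun i _ => ?_
    generalize x i * y i = a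
    revert a
    decide
  rw [← hc, ZMod.natCast_eq_zero_iff]
  have h1 := h x hx
  have h2 := h y hy
  have h3 := h _ (C.add_mem hx hy)
  have h4 := wt_add_zmod_two x y
  omega

/-- If `q·r_{q,n,k,d} < k`, then there is no LCD `[n,k,d]` code over `𝔽_q` with dual
distance `≥ 2`, where `r_{q,n,k,d} = q^{k-1}·n − [k]_q·d`. -/
theorem no_lcd_of_qr_lt_k {q k₀ k n d : ℕ}
    (hq : (q = 2 ∧ k₀ = 3) ∨ (q = 3 ∧ k₀ = 2)) (hk : k₀ ≤ k)
    (hd : 1 ≤ (q : ℤ) * d - ((q : ℤ) - 1) * n)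
    (hqr : (q : ℤ) * ((q : ℤ) ^ (k - 1) * n - (qrep q k : ℤ) * d) < k) :
    ¬ ∃ C : Submodule (ZMod q) (Fin n → ZMod q),
      Module.finrank (ZMod q) C = k ∧ IsLCD C ∧ HasMinWeight C d ∧ DualDistGe C 2 := by
  rintro ⟨C, hkC, hL, ⟨⟨x₀, hx₀, hx₀0, -⟩, hmin⟩, hdual⟩
  have hCbot : C ≠ ⊥ := fun h => hx₀0 (by simpa [h] using hx₀)
  have hwt : ∀ e, e ∣ d → (∀ x ∈ C, x ≠ 0 → wt x = d) → ∀ x ∈ C, e ∣ wt x := by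
    intro e he hconst x hx
    by_cases h0 : x = 0
    · simp [h0, wt]
    · rwa [hconst x hx h0]
  rcases hq with ⟨rfl, rfl⟩ | ⟨rfl, rfl⟩
  · have : Fintype C := Fintype.ofFinite C
    have hconst := wt_eq_of_card_mul_lt hdual (by omega) hmin
      (by rw [hkC, ZMod.card]; exact hqr)
    have hdvd := card_pow_dvd_of_wt_eq hdual (by omega) hconst
    rw [hkC, ZMod.card] at hdvd
    have h4 : 2 ^ 2 ∣ d := (pow_dvd_pow 2 (by omega)).trans hdvd
    exact not_isLCD_of_dot_eq_zero (dot_eq_zero_of_four_dvd_wt (hwt _ h4 hconst)) hCbot hL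
  · have : Fintype C := Fintype.ofFinite C
    have hconst := wt_eq_of_card_mul_lt hdual (by omega) hmin
      (by rw [hkC, ZMod.card]; exact hqr)
    have hdvd := card_pow_dvd_of_wt_eq hdual (by omega) hconst
    rw [hkC, ZMod.card] at hdvd
    have h3 : 3 ^ 1 ∣ d := (pow_dvd_pow 3 (by omega)).trans hdvd
    exact not_isLCD_of_dot_eq_zero (dot_eq_zero_of_three_dvd_wt (hwt _ h3 hconst)) hCbot hL
end

section
/- Suppose (q,k₀) ∈ {(2,3),(3,2)}, k ≥ k₀ and q·d − (q−1)·n ≥ 1, and let r = r_{q,n,k,d} = q^{k−1}·n − [k]_q·d. Let D and D′ be codes over 𝔽_q with generator matrices (S_{q,k}^{(qd−(q−1)n)} | G₀) and (S_{q,k}^{(qd−(q−1)n)} | G₀′) respectively, where G₀ and G₀′ are generator matrices of [q·r, k] codes C₀ and C₀′ over 𝔽_q. If C₀ is equivalent to C₀′, then D is equivalent to D′. -/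
open Matrix Finset

lemma exists_eq_smul_simplexCol {q : ℕ} [Fact q.Prime] :
    ∀ {k : ℕ} {v : Fin k → ZMod q}, v ≠ 0 →
      ∃ (j : Fin (qrep q k)) (c : (ZMod q)ˣ), v = (c : ZMod q) • simplexCol q k j := by
  intro k
  induction k with
  | zero => exact fun {v} hv => absurd (Subsingleton.elim v 0) hv
  | succ k ih =>
    intro v hv
    have hsucc : qrep q (k + 1) = q * qrep q k + 1 := by
      simp [qrep, Finset.sum_range_succ', Finset.mul_sum, pow_succ, mul_comm]
    have hq : 2 ≤ q := (Fact.out : q.Prime).two_le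
    have hle : 2 * qrep q k ≤ q * qrep q k := Nat.mul_le_mul_right _ hq
    obtain ⟨w, a, rfl⟩ : ∃ w : Fin k → ZMod q, ∃ a, v = Fin.snoc w a :=
      ⟨Fin.init v, v (Fin.last k), (Fin.snoc_init_self v).symm⟩
    have smul_snoc (c b : ZMod q) (u : Fin k → ZMod q) :
        c • (Fin.snoc u b : Fin (k + 1) → ZMod q) = Fin.snoc (c • u) (c * b) := by
      ext i; refine Fin.lastCases ?_ (fun i => ?_) i <;> simp
    by_cases hw : w = 0
    · subst hw
      have ha : a ≠ 0 := by
        rintro rfl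
        exact hv (by ext i; refine Fin.lastCases ?_ (fun i => ?_) i <;> simp)
      refine ⟨⟨qrep q k, by omega⟩, Units.mk0 a ha, ?_⟩
      simp only [simplexCol, lt_irrefl, if_false, if_true, Units.val_mk0, smul_snoc, mul_one]
      congr 1
      ext i; simp
    · obtain ⟨⟨j, hj⟩, c, rfl⟩ := ih hw
      by_cases ha : a = 0
      · refine ⟨⟨j, by omega⟩, c, ?_⟩
        simp [simplexCol, hj, smul_snoc, ha]
      · set t : ZMod q := (c⁻¹ : (ZMod q)ˣ) * a with ht
        have ht0 : t ≠ 0 := mul_ne_zero (Units.ne_zero _) ha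
        obtain ⟨s, hs⟩ : ∃ s, t.val = s + 1 :=
          Nat.exists_eq_succ_of_ne_zero (by simpa [ZMod.val_eq_zero] using ht0)
        have hsq : s + 2 ≤ q := by have := ZMod.val_lt t; omega
        have hmul := Nat.mul_le_mul_right (qrep q k) hsq
        rw [add_mul] at hmul
        refine ⟨⟨qrep q k + 1 + (j + qrep q k * s), ?_⟩, c, ?_⟩
        · rw [hsucc]; nlinarith
        · have hsub : qrep q k + 1 + (j + qrep q k * s) - qrep q k - 1 = j + qrep q k * s := by
            omega
          have hdiv : (j + qrep q k * s) / qrep q k = s := by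
            rw [Nat.add_mul_div_left _ _ (by omega), Nat.div_eq_of_lt hj, zero_add]
          have hmod : (j + qrep q k * s) % qrep q k = j := by
            rw [Nat.add_mul_mod_self_left, Nat.mod_eq_of_lt hj]
          have hc : (c : ZMod q) * t = a := Units.mul_inv_cancel_left c a
          simp only [simplexCol]
          rw [if_neg (by omega), if_neg (by omega), hsub, hdiv, hmod, ← hs, smul_snoc,
            ZMod.natCast_zmod_val, hc]

/-- The columns of `S_{q,k}` represent each point of the projective space exactly once. -/
lemma bijective_smul_simplexCol {q : ℕ} [Fact q.Prime] (k : ℕ) :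
    Function.Bijective fun p : Option (Fin (qrep q k) × (ZMod q)ˣ) =>
      p.elim (0 : Fin k → ZMod q) fun p => (p.2 : ZMod q) • simplexCol q k p.1 := by
  rw [Fintype.bijective_iff_surjective_and_card]
  constructor
  · intro v
    by_cases hv : v = 0
    · exact ⟨none, hv.symm⟩
    · obtain ⟨j, c, h⟩ := exists_eq_smul_simplexCol hv
      exact ⟨some (j, c), h.symm⟩
  · have hq : 1 ≤ q := (Fact.out : q.Prime).one_le
    simp only [Fintype.card_option, Fintype.card_prod, Fintype.card_fin, ZMod.card_units,
      Fintype.card_fun, ZMod.card]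
    simpa [qrep, Nat.sub_add_cancel hq] using geom_sum_mul_add (q - 1) k

/-- An invertible matrix permutes the columns of `S_{q,k}` up to nonzero scalars. -/
lemma exists_perm_mulVec_simplexCol {q k : ℕ} [Fact q.Prime]
    {T : Matrix (Fin k) (Fin k) (ZMod q)} (hT : IsUnit T) :
    ∃ (σ : Equiv.Perm (Fin (qrep q k))) (c : Fin (qrep q k) → ZMod q), (∀ j, c j ≠ 0) ∧
      ∀ j, T *ᵥ simplexCol q k (σ j) = c j • simplexCol q k j := by
  have hinj := (bijective_smul_simplexCol (q := q) k).injective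
  have hTinj := Matrix.mulVec_injective_of_isUnit hT
  have hne (j : Fin (qrep q k)) : simplexCol q k j ≠ 0 := fun h => by
    simpa using @hinj (some (j, 1)) none (by simpa using h)
  have hex (j : Fin (qrep q k)) : ∃ (i : Fin (qrep q k)) (c : (ZMod q)ˣ),
      T *ᵥ simplexCol q k j = (c : ZMod q) • simplexCol q k i :=
    exists_eq_smul_simplexCol fun h => hne j (hTinj (by simpa using h))
  choose τ c h using hex
  have hcol (j : Fin (qrep q k)) :
      T *ᵥ (((c j)⁻¹ : (ZMod q)ˣ) : ZMod q) • simplexCol q k j = simplexCol q k (τ j) := by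
    rw [Matrix.mulVec_smul, h, smul_smul, Units.inv_mul, one_smul]
  have hτ : Function.Injective τ := by
    intro i j hij
    have key : (some (i, (c i)⁻¹) : Option (Fin (qrep q k) × (ZMod q)ˣ)) =
        some (j, (c j)⁻¹) := by
      apply hinj
      apply hTinj
      exact (hcol i).trans (hij ▸ (hcol j).symm)
    simp only [Option.some.injEq, Prod.mk.injEq] at key
    exact key.1
  let σ := Equiv.ofBijective τ (Finite.injective_iff_bijective.mp hτ)
  refine ⟨σ.symm, fun j => c (σ.symm j), fun j => Units.ne_zero _, fun j => ?_⟩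
  rw [h]
  exact congrArg (fun i : Fin (qrep q k) => _ • simplexCol q k i) (σ.apply_symm_apply j)

/-- Generator matrices whose columns correspond, up to nonzero scalars, a permutation and an
invertible change of basis, generate equivalent codes. -/
lemma codeEquiv_of_mulVec_col {R : Type*} [CommRing R] {k n : ℕ}
    {D D' : Submodule R (Fin n → R)} {M M' : Matrix (Fin k) (Fin n) R}
    (hD : IsGenMatrix D M) (hD' : IsGenMatrix D' M')
    {T : Matrix (Fin k) (Fin k) R} (hT : IsUnit T) (σ : Equiv.Perm (Fin n)) (c : Fin n → R)
    (hc : ∀ j, c j ≠ 0) (h : ∀ j, T *ᵥ M'.col (σ j) = c j • M.col j) :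
    codeEquiv D D' := by
  let P : Matrix (Fin n) (Fin n) R := Matrix.of fun i j => if σ i = j then c i else 0
  refine ⟨P, ⟨σ, c, hc, fun _ _ => rfl⟩, ?_⟩
  have hMP : M * P = T * M' := by
    ext a j
    obtain ⟨j, rfl⟩ := σ.surjective j
    have := congrFun (h j) a
    simp only [Matrix.mulVec, dotProduct, Matrix.col_apply, Pi.smul_apply, smul_eq_mul] at this
    simp [Matrix.mul_apply, P, this, mul_comm]
  have hspan (A : Matrix (Fin k) (Fin n) R) :
      Submodule.span R (Set.range fun i => A i) = LinearMap.range A.vecMulLinear :=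
    (range_vecMulLinear A).symm
  have hmul {m : ℕ} (A : Matrix (Fin k) (Fin m) R) (B : Matrix (Fin m) (Fin n) R) :
      (A * B).vecMulLinear = B.vecMulLinear ∘ₗ A.vecMulLinear :=
    LinearMap.ext fun x => (Matrix.vecMul_vecMul x A B).symm
  have hTtop : LinearMap.range T.vecMulLinear = ⊤ :=
    LinearMap.range_eq_top.mpr (Matrix.vecMul_surjective_iff_isUnit.mpr hT)
  rw [← hD.2, ← hD'.2, hspan, hspan, ← LinearMap.range_comp, ← hmul, hMP, hmul,
    LinearMap.range_comp, hTtop, LinearMap.range_eq_map]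

lemma exists_mulVec_col_of_codeEquiv {K : Type*} [Field K] {k n : ℕ}
    {C C' : Submodule K (Fin n → K)} {G G' : Matrix (Fin k) (Fin n) K}
    (hG : IsGenMatrix C G) (hG' : IsGenMatrix C' G') (h : codeEquiv C C') :
    ∃ T : Matrix (Fin k) (Fin k) K, IsUnit T ∧ ∃ (σ : Equiv.Perm (Fin n)) (c : Fin n → K),
      (∀ j, c j ≠ 0) ∧ ∀ j, T *ᵥ G'.col (σ j) = c j • G.col j := by
  obtain ⟨P, ⟨σ, c, hc, hP⟩, hC'⟩ := h
  have hvec (v : Fin n → K) (j : Fin n) : (v ᵥ* P) (σ j) = c j * v j := by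
    simp [Matrix.vecMul, dotProduct, hP, mul_comm]
  have hPinj (v : Fin n → K) (hv : v ᵥ* P = 0) : v = 0 := by
    ext j
    have := hvec v j
    rw [hv] at this
    simpa [hc j] using this.symm
  have hmem (a : Fin k) : ∃ t : Fin k → K, t ᵥ* G' = G a ᵥ* P := by
    have : G a ᵥ* P ∈ LinearMap.range G'.vecMulLinear := by
      rw [range_vecMulLinear]
      change _ ∈ Submodule.span K (Set.range fun i => G' i)
      rw [hG'.2, hC', ← hG.2]
      exact ⟨G a, Submodule.subset_span ⟨a, rfl⟩, rfl⟩
    exact this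
  choose t ht using hmem
  let T : Matrix (Fin k) (Fin k) K := Matrix.of t
  have hTG : T * G' = G * P := by
    ext a j
    exact congrFun (ht a) j
  have hGinj : Function.Injective G.vecMul := Matrix.vecMul_injective_iff.mpr hG.1
  refine ⟨T, ?_, σ, c, hc, fun j => ?_⟩
  · rw [← Matrix.vecMul_injective_iff_isUnit]
    refine (injective_iff_map_eq_zero T.vecMulLinear).mpr fun x hx => ?_
    have hx' : x ᵥ* T = 0 := hx
    apply hGinj
    change x ᵥ* G = 0 ᵥ* G
    rw [Matrix.zero_vecMul]
    apply hPinj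
    rw [Matrix.vecMul_vecMul, ← hTG, ← Matrix.vecMul_vecMul, hx', Matrix.zero_vecMul]
  · ext a
    exact (congrFun (ht a) (σ j)).trans (hvec (G a) j)

section Juxtaposition

variable {R : Type*} {k a b : ℕ}

lemma hcat_col_castAdd (A : Matrix (Fin k) (Fin a) R) (B : Matrix (Fin k) (Fin b) R)
    (j : Fin a) : (hcat A B).col (Fin.castAdd b j) = A.col j := by
  ext i; simp [hcat]

lemma hcat_col_natAdd (A : Matrix (Fin k) (Fin a) R) (B : Matrix (Fin k) (Fin b) R)
    (j : Fin b) : (hcat A B).col (Fin.natAdd a j) = B.col j := by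
  ext i; simp [hcat]

/-- Positions in `A^{(s)}`, as pairs of a copy of `A` and a column of `A`. -/
def repsIndex (a s : ℕ) : Fin s × Fin a ≃ Fin (a * s) :=
  finProdFinEquiv.trans (finCongr (mul_comm s a))

lemma reps_col_repsIndex (A : Matrix (Fin k) (Fin a) R) {s : ℕ} (p : Fin s × Fin a) :
    (reps A s).col (repsIndex a s p) = A.col p.2 := by
  ext i
  simp [reps, repsIndex, Nat.mod_eq_of_lt]

variable [CommRing R] {T : Matrix (Fin k) (Fin k) R}

lemma exists_mulVec_col_reps {A A' : Matrix (Fin k) (Fin a) R} (s : ℕ)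
    (h : ∃ (σ : Equiv.Perm (Fin a)) (c : Fin a → R),
      (∀ j, c j ≠ 0) ∧ ∀ j, T *ᵥ A'.col (σ j) = c j • A.col j) :
    ∃ (σ : Equiv.Perm (Fin (a * s))) (c : Fin (a * s) → R),
      (∀ j, c j ≠ 0) ∧ ∀ j, T *ᵥ (reps A' s).col (σ j) = c j • (reps A s).col j := by
  obtain ⟨σ, c, hc, h⟩ := h
  refine ⟨(repsIndex a s).permCongr ((Equiv.refl _).prodCongr σ),
    fun j => c ((repsIndex a s).symm j).2, fun j => hc _, fun j => ?_⟩
  obtain ⟨p, rfl⟩ := (repsIndex a s).surjective j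
  simp [Equiv.permCongr_apply, reps_col_repsIndex, h]

lemma exists_mulVec_col_hcat {A A' : Matrix (Fin k) (Fin a) R} {B B' : Matrix (Fin k) (Fin b) R}
    (hA : ∃ (σ : Equiv.Perm (Fin a)) (c : Fin a → R),
      (∀ j, c j ≠ 0) ∧ ∀ j, T *ᵥ A'.col (σ j) = c j • A.col j)
    (hB : ∃ (σ : Equiv.Perm (Fin b)) (c : Fin b → R),
      (∀ j, c j ≠ 0) ∧ ∀ j, T *ᵥ B'.col (σ j) = c j • B.col j) :
    ∃ (σ : Equiv.Perm (Fin (a + b))) (c : Fin (a + b) → R),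
      (∀ j, c j ≠ 0) ∧ ∀ j, T *ᵥ (hcat A' B').col (σ j) = c j • (hcat A B).col j := by
  obtain ⟨σ, c, hc, hA⟩ := hA
  obtain ⟨τ, d, hd, hB⟩ := hB
  refine ⟨finSumFinEquiv.permCongr (σ.sumCongr τ), Fin.append c d, fun j => ?_, fun j => ?_⟩ <;>
    refine Fin.addCases (fun j => ?_) (fun j => ?_) j
  · simpa using hc j
  · simpa using hd j
  · simp [Equiv.permCongr_apply, hcat_col_castAdd, hA]
  · simp [Equiv.permCongr_apply, hcat_col_natAdd, hB]

end Juxtaposition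

/-- If `C₀` and `C₀'` are equivalent `[q·r, k]` codes, then the codes with generator
matrices `(S_{q,k}^{(qd−(q−1)n)} | G₀)` and `(S_{q,k}^{(qd−(q−1)n)} | G₀')` are
equivalent. -/
theorem equiv_of_equiv_tail {q k₀ k n d e r : ℕ}
    (hq : (q = 2 ∧ k₀ = 3) ∨ (q = 3 ∧ k₀ = 2)) (hk : k₀ ≤ k)
    (he : (e : ℤ) = (q : ℤ) * d - ((q : ℤ) - 1) * n) (he1 : 1 ≤ e)
    (hr : (r : ℤ) = (q : ℤ) ^ (k - 1) * n - (qrep q k : ℤ) * d)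
    (G₀ G₀' : Matrix (Fin k) (Fin (q * r)) (ZMod q))
    (C₀ C₀' : Submodule (ZMod q) (Fin (q * r) → ZMod q))
    (hG₀ : IsGenMatrix C₀ G₀) (hG₀' : IsGenMatrix C₀' G₀')
    (hC₀ : Module.finrank (ZMod q) C₀ = k) (hC₀' : Module.finrank (ZMod q) C₀' = k)
    (D D' : Submodule (ZMod q) (Fin (qrep q k * e + q * r) → ZMod q))
    (hD : IsGenMatrix D (hcat (reps (simplexMatrix q k) e) G₀))
    (hD' : IsGenMatrix D' (hcat (reps (simplexMatrix q k) e) G₀'))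
    (hequiv : codeEquiv C₀ C₀') :
    codeEquiv D D' := by
  have : Fact q.Prime := ⟨by
    rcases hq with ⟨rfl, -⟩ | ⟨rfl, -⟩
    · exact Nat.prime_two
    · exact Nat.prime_three⟩
  obtain ⟨T, hT, htail⟩ := exists_mulVec_col_of_codeEquiv hG₀ hG₀' hequiv
  obtain ⟨σ, c, hc, h⟩ := exists_mulVec_col_hcat
    (exists_mulVec_col_reps (A := simplexMatrix q k) (A' := simplexMatrix q k) e
      (exists_perm_mulVec_simplexCol hT)) htail
  exact codeEquiv_of_mulVec_col hD hD' hT σ c hc h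
end

section
/- Suppose q ∈ {2,3}, k ≥ 1 and s ∈ ℤ_{≥0}. Let B and B′ be [ℓ,k] codes over 𝔽_q with generator matrices M and M′ respectively, and let C and C′ be the [n,k] codes over 𝔽_q with generator matrices (S_{q,k}^{(s)} | M) and (S_{q,k}^{(s)} | M′) respectively, where n = [k]_q·s + ℓ. If B is not equivalent to B′, then C is not equivalent to C′. -/
open Matrix Finset

lemma map_univ_val_eq_map_univ_val_iff {α β : Type*} [Fintype α] {f g : α → β} :
    (Finset.univ : Finset α).val.map f = (Finset.univ : Finset α).val.map g ↔
      ∃ σ : Equiv.Perm α, f = g ∘ σ := by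
  classical
  constructor
  · intro h
    have hfiber (c : β) : Nonempty ({a // f a = c} ≃ {a // g a = c}) := by
      have hc := congrArg (Multiset.count c) h
      rw [Multiset.count_map, Multiset.count_map] at hc
      refine Fintype.card_eq.1 ?_
      rw [Fintype.card_subtype, Fintype.card_subtype]
      simpa only [eq_comm, Finset.card_def, Finset.filter_val] using hc
    exact ⟨Equiv.ofFiberEquiv fun c => (hfiber c).some,
      funext fun a => (Equiv.ofFiberEquiv_map _ a).symm⟩
  · rintro ⟨σ, rfl⟩
    rw [← Multiset.map_map, Multiset.map_univ_val_equiv]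

section ProjClasses

variable {F : Type*} [Field F] {k : ℕ}

/-- The class of a vector up to multiplication by nonzero scalars. -/
def projClass (x : Fin k → F) : Quotient (MulAction.orbitRel Fˣ (Fin k → F)) :=
  Quotient.mk _ x

lemma projClass_eq_iff {x y : Fin k → F} :
    projClass x = projClass y ↔ ∃ u : Fˣ, u • y = x := by
  rw [projClass, projClass, Quotient.eq, MulAction.orbitRel_apply, MulAction.mem_orbit_iff]

/-- The multiset of columns of a matrix, up to nonzero scalars. -/
def projClasses {n : ℕ} (G : Matrix (Fin k) (Fin n) F) :
    Multiset (Quotient (MulAction.orbitRel Fˣ (Fin k → F))) :=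
  (Finset.univ : Finset (Fin n)).val.map fun j => projClass (Gᵀ j)

lemma projClasses_hcat {a b : ℕ} (X : Matrix (Fin k) (Fin a) F) (Y : Matrix (Fin k) (Fin b) F) :
    projClasses (hcat X Y) = projClasses X + projClasses Y := by
  have hX (j : Fin a) : (hcat X Y)ᵀ (Fin.castAdd b j) = Xᵀ j := by
    ext i; simp [hcat]
  have hY (j : Fin b) : (hcat X Y)ᵀ (Fin.natAdd a j) = Yᵀ j := by
    ext i; simp [hcat]
  have h : (Finset.univ : Finset (Fin (a + b))).val =
      ((Finset.univ : Finset (Fin a ⊕ Fin b)).map finSumFinEquiv.toEmbedding).val := by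
    rw [Finset.map_univ_equiv]
  rw [projClasses, h, Finset.map_val, Multiset.map_map, ← Finset.univ_disjSum_univ,
    Finset.val_disjSum, Multiset.disjSum, Multiset.map_add, Multiset.map_map, Multiset.map_map]
  simp [projClasses, Function.comp_def, hX, hY]

lemma reps_succ {R : Type*} {r : ℕ} (X : Matrix (Fin k) (Fin r) R) (s : ℕ) :
    reps X (s + 1) = hcat (reps X s) X := by
  ext i j
  have hj : (j : ℕ) < r * s + r := j.isLt
  simp only [reps, hcat, Matrix.of_apply]
  split_ifs with h
  · rfl
  · congr 2
    have e : (j : ℕ) = ((j : ℕ) - r * s) + r * s := by omega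
    rw [e, Nat.add_mul_mod_self_left, Nat.mod_eq_of_lt (by omega)]
    simp

lemma projClasses_reps {r : ℕ} (X : Matrix (Fin k) (Fin r) F) (s : ℕ) :
    projClasses (reps X s) = s • projClasses X := by
  induction s with
  | zero => simp [projClasses]
  | succ s ih => rw [reps_succ, succ_nsmul, ← ih]; exact projClasses_hcat _ _

lemma mul_hcat {a b : ℕ} (A : Matrix (Fin k) (Fin k) F) (X : Matrix (Fin k) (Fin a) F)
    (Y : Matrix (Fin k) (Fin b) F) : A * hcat X Y = hcat (A * X) (A * Y) := by
  ext i j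
  simp only [Matrix.mul_apply, hcat, Matrix.of_apply]
  split_ifs <;> rfl

lemma mul_reps {r : ℕ} (A : Matrix (Fin k) (Fin k) F) (X : Matrix (Fin k) (Fin r) F) (s : ℕ) :
    A * reps X s = reps (A * X) s := by
  ext i j
  simp [Matrix.mul_apply, reps]

lemma IsGenMatrix.mem_iff {n : ℕ} {C : Submodule F (Fin n → F)} {G : Matrix (Fin k) (Fin n) F}
    (h : IsGenMatrix C G) {x : Fin n → F} : x ∈ C ↔ ∃ y, y ᵥ* G = x := by
  rw [← h.2, show Set.range (fun i => G i) = Set.range G.row from rfl, ← range_vecMulLinear]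
  simp

lemma projClasses_eq_iff {n : ℕ} {G G' : Matrix (Fin k) (Fin n) F} :
    projClasses G' = projClasses G ↔
      ∃ P : Matrix (Fin n) (Fin n) F, IsMonomial P ∧ G' = G * P := by
  constructor
  · intro h
    obtain ⟨σ, hσ⟩ := (map_univ_val_eq_map_univ_val_iff).1 h.symm
    choose u hu using fun j => projClass_eq_iff.1 (congrFun hσ j).symm
    refine ⟨Matrix.of fun i j => if σ i = j then (u i : F) else 0,
      ⟨σ, fun i => u i, fun i => (u i).ne_zero, fun i j => rfl⟩, ?_⟩
    ext i j
    obtain ⟨j, rfl⟩ := σ.surjective j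
    have := congrFun (hu j) i
    simpa [Matrix.mul_apply, Units.smul_def, mul_comm, eq_comm] using this
  · rintro ⟨P, ⟨σ, c, hc, hP⟩, rfl⟩
    refine ((map_univ_val_eq_map_univ_val_iff).2 ⟨σ, funext fun j => ?_⟩).symm
    refine (projClass_eq_iff.2 ⟨Units.mk0 (c j) (hc j), ?_⟩).symm
    ext i
    simp [Matrix.mul_apply, hP, Units.smul_def, mul_comm]

lemma codeEquiv_iff {n : ℕ} {C C' : Submodule F (Fin n → F)} {G G' : Matrix (Fin k) (Fin n) F}
    (h : IsGenMatrix C G) (h' : IsGenMatrix C' G') :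
    codeEquiv C C' ↔ ∃ A : Matrix (Fin k) (Fin k) F, IsUnit A ∧
      projClasses G' = projClasses (A * G) := by
  simp_rw [projClasses_eq_iff]
  constructor
  · rintro ⟨P, hP, hC⟩
    have hrow (i : Fin k) : ∃ a, a ᵥ* G ᵥ* P = G' i := by
      have hi : G' i ∈ C' := h'.2 ▸ Submodule.subset_span ⟨i, rfl⟩
      rw [hC] at hi
      obtain ⟨y, hy, hyi⟩ := hi
      obtain ⟨a, rfl⟩ := h.mem_iff.1 hy
      exact ⟨a, hyi⟩
    choose A hA using hrow
    have hG : G' = Matrix.of A * G * P := by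
      ext i j
      rw [← hA i]
      simp [Matrix.mul_apply, Matrix.vecMul, dotProduct]
    refine ⟨Matrix.of A, ?_, P, hP, hG⟩
    have hinj : Function.Injective G'.vecMul := Matrix.vecMul_injective_iff.2 h'.1
    rw [← Matrix.vecMul_injective_iff_isUnit]
    intro x y hxy
    apply hinj
    simp only [hG, ← Matrix.vecMul_vecMul]
    simp only at hxy
    rw [hxy]
  · rintro ⟨A, hA, P, hP, hG⟩
    refine ⟨P, hP, ?_⟩
    ext x
    rw [h'.mem_iff, Submodule.mem_map]
    constructor
    · rintro ⟨y, rfl⟩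
      exact ⟨y ᵥ* A ᵥ* G, h.mem_iff.2 ⟨_, rfl⟩, by simp [hG]⟩
    · rintro ⟨z, hz, rfl⟩
      obtain ⟨w, rfl⟩ := h.mem_iff.1 hz
      obtain ⟨y, rfl : y ᵥ* A = w⟩ := Matrix.vecMul_surjective_iff_isUnit.2 hA w
      exact ⟨y, by simp [hG]⟩

end ProjClasses

section Simplex

variable {q : ℕ} [Fact q.Prime] {k : ℕ}

/-- If every nonzero vector is proportional to one of only `[k]_q` columns, then the columns
represent every point of projective space exactly once. -/
lemma nodup_projClasses_and_mem_iff {X : Matrix (Fin k) (Fin (qrep q k)) (ZMod q)}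
    (hX : ∀ v ≠ 0, ∃ j, ∃ u : (ZMod q)ˣ, u • Xᵀ j = v) :
    (projClasses X).Nodup ∧ ∀ p, p ∈ projClasses X ↔ p ≠ projClass 0 := by
  classical
  let f : Fin (qrep q k) × (ZMod q)ˣ → Fin k → ZMod q := fun p => p.2 • Xᵀ p.1
  have hq : 1 ≤ q := (Fact.out : q.Prime).one_le
  have hcard : (Finset.univ : Finset (Fin (qrep q k) × (ZMod q)ˣ)).card =
      ({0}ᶜ : Finset (Fin k → ZMod q)).card := by
    rw [Finset.card_univ, Fintype.card_prod, ZMod.card_units, Fintype.card_fin,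
      Finset.card_compl, Finset.card_singleton, Fintype.card_fun, ZMod.card, Fintype.card_fin,
      qrep, geom_sum_mul_of_one_le hq]
  have hsub : ({0}ᶜ : Finset (Fin k → ZMod q)) ⊆ Finset.univ.image f := by
    intro v hv
    obtain ⟨j, u, h⟩ := hX v (by simpa using hv)
    exact Finset.mem_image.2 ⟨(j, u), Finset.mem_univ _, h⟩
  have himage := Finset.eq_of_subset_of_card_le hsub (hcard ▸ Finset.card_image_le)
  have hinj : Set.InjOn f (Finset.univ : Finset (Fin (qrep q k) × (ZMod q)ˣ)) :=
    Finset.card_image_iff.1 (by rw [← himage, hcard])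
  have hne (j) : Xᵀ j ≠ 0 := by
    have : f (j, 1) ∈ ({0}ᶜ : Finset (Fin k → ZMod q)) :=
      himage ▸ Finset.mem_image_of_mem f (Finset.mem_univ _)
    simpa [f] using this
  constructor
  · refine Multiset.Nodup.map (fun i j hij => ?_) Finset.univ.nodup
    obtain ⟨u, hu⟩ := projClass_eq_iff.1 hij
    have : f (j, u) = f (i, 1) := by simpa [f] using hu
    exact (congrArg Prod.fst (hinj (by simp) (by simp) this)).symm
  · intro p
    induction p using Quotient.inductionOn with
    | h v =>
      change projClass v ∈ _ ↔ projClass v ≠ _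
      simp only [projClasses, Multiset.mem_map, Finset.mem_val, Finset.mem_univ, true_and]
      constructor
      · rintro ⟨j, hj⟩ h
        obtain ⟨u, hu⟩ := projClass_eq_iff.1 (hj.trans h)
        exact hne j (by simpa using hu.symm)
      · intro hv
        obtain ⟨j, u, h⟩ := hX v fun h => hv (h ▸ rfl)
        exact ⟨j, (projClass_eq_iff.2 ⟨u, h⟩).symm⟩

lemma exists_smul_simplexCol {v : Fin k → ZMod q} (hv : v ≠ 0) :
    ∃ j < qrep q k, ∃ u : (ZMod q)ˣ, u • simplexCol q k j = v := by
  have hq : 1 < q := (Fact.out : q.Prime).one_lt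
  induction k with
  | zero => exact absurd (Subsingleton.elim v 0) hv
  | succ k ih =>
    have hr : qrep q (k + 1) = q * qrep q k + 1 := by
      simp only [qrep, Finset.sum_range_succ', Finset.mul_sum, pow_succ', pow_zero]
    have hle : qrep q k ≤ q * qrep q k := Nat.le_mul_of_pos_left _ (by omega)
    have hsmul (u : (ZMod q)ˣ) (w : Fin k → ZMod q) (a : ZMod q) :
        u • (Fin.snoc w a : Fin (k + 1) → ZMod q) = Fin.snoc (u • w) (u * a) := by
      ext i
      refine Fin.lastCases ?_ (fun i => ?_) i <;> simp [Units.smul_def]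
    obtain ⟨w, a, rfl⟩ : ∃ (w : Fin k → ZMod q) (a : ZMod q), v = Fin.snoc w a :=
      ⟨Fin.init v, v (Fin.last k), (Fin.snoc_init_self v).symm⟩
    by_cases hw : w = 0
    · subst hw
      have ha : a ≠ 0 := by
        rintro rfl
        apply hv
        ext i
        refine Fin.lastCases ?_ (fun i => ?_) i <;> simp
      refine ⟨qrep q k, by omega, Units.mk0 a ha, ?_⟩
      rw [simplexCol, if_neg (lt_irrefl _), if_pos rfl, hsmul]
      congr 1
      · ext; simp
      · simp
    · obtain ⟨j, hj, u, hu⟩ := ih hw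
      by_cases ha : a = 0
      · refine ⟨j, by omega, u, ?_⟩
        rw [simplexCol, if_pos hj, hsmul, hu, ha, mul_zero]
      · obtain ⟨b, hb⟩ : ∃ b, (((u⁻¹ : (ZMod q)ˣ) : ZMod q) * a).val = b + 1 :=
          Nat.exists_eq_succ_of_ne_zero
            ((ZMod.val_ne_zero _).2 (mul_ne_zero u⁻¹.ne_zero ha))
        have hbq : b + 1 < q := hb ▸ ZMod.val_lt _
        refine ⟨qrep q k + 1 + (j + qrep q k * b), ?_, u, ?_⟩
        · have := Nat.mul_le_mul_left (qrep q k) (show b + 2 ≤ q by omega)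
          rw [hr, mul_comm q]
          linarith
        · have e : qrep q k + 1 + (j + qrep q k * b) - qrep q k - 1 = j + qrep q k * b := by omega
          rw [simplexCol, if_neg (by omega), if_neg (by omega), hsmul, e,
            Nat.add_mul_mod_self_left, Nat.mod_eq_of_lt hj, hu,
            Nat.add_mul_div_left _ _ (by omega), Nat.div_eq_of_lt hj, zero_add, ← hb,
            ZMod.natCast_zmod_val, Units.mul_inv_cancel_left]

lemma projClasses_mul_simplexMatrix {A : Matrix (Fin k) (Fin k) (ZMod q)} (hA : IsUnit A) :
    projClasses (A * simplexMatrix q k) = projClasses (simplexMatrix q k) := by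
  have hS (v : Fin k → ZMod q) (hv : v ≠ 0) :
      ∃ j, ∃ u : (ZMod q)ˣ, u • (simplexMatrix q k)ᵀ j = v := by
    obtain ⟨j, hj, u, hu⟩ := exists_smul_simplexCol hv
    exact ⟨⟨j, hj⟩, u, hu⟩
  have hAS (v : Fin k → ZMod q) (hv : v ≠ 0) :
      ∃ j, ∃ u : (ZMod q)ˣ, u • (A * simplexMatrix q k)ᵀ j = v := by
    obtain ⟨w, rfl⟩ := Matrix.mulVec_surjective_iff_isUnit.2 hA v
    obtain ⟨j, u, rfl⟩ := hS w fun h => hv (by simp [h])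
    refine ⟨j, u, ?_⟩
    rw [Units.smul_def, Units.smul_def, Matrix.mulVec_smul]
    rfl
  obtain ⟨hn, hm⟩ := nodup_projClasses_and_mem_iff hS
  obtain ⟨hn', hm'⟩ := nodup_projClasses_and_mem_iff hAS
  exact (Multiset.Nodup.ext hn' hn).2 fun p => (hm' p).trans (hm p).symm

end Simplex

/-- If `B` and `B'` are inequivalent `[ℓ,k]` codes, then the codes with generator matrices
`(S_{q,k}^{(s)} | M)` and `(S_{q,k}^{(s)} | M')` are inequivalent. -/
theorem not_equiv_of_not_equiv_tail {q k s ℓ : ℕ} (hq : q = 2 ∨ q = 3) (hk : 1 ≤ k)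
    (M M' : Matrix (Fin k) (Fin ℓ) (ZMod q))
    (B B' : Submodule (ZMod q) (Fin ℓ → ZMod q))
    (hB : IsGenMatrix B M) (hB' : IsGenMatrix B' M')
    (hBk : Module.finrank (ZMod q) B = k) (hB'k : Module.finrank (ZMod q) B' = k)
    (C C' : Submodule (ZMod q) (Fin (qrep q k * s + ℓ) → ZMod q))
    (hC : IsGenMatrix C (hcat (reps (simplexMatrix q k) s) M))
    (hC' : IsGenMatrix C' (hcat (reps (simplexMatrix q k) s) M'))
    (hne : ¬ codeEquiv B B') :
    ¬ codeEquiv C C' := by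
  have : Fact q.Prime := ⟨by rcases hq with rfl | rfl <;> decide⟩
  refine fun h => hne ?_
  obtain ⟨A, hA, h⟩ := (codeEquiv_iff hC hC').1 h
  rw [mul_hcat, mul_reps, projClasses_hcat, projClasses_hcat, projClasses_reps, projClasses_reps,
    projClasses_mul_simplexMatrix hA] at h
  exact (codeEquiv_iff hB hB').2 ⟨A, hA, add_left_cancel h⟩
end
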